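/- Assume Hypothesis (B): every involution on A₁ is conjugate to α. Let f be an endomorphism of A₁ with P = f(X), Q = f(Y) and image T = f(A₁). If α(P) ∈ T and α(Q) ∈ T (so that α restricted to T is an involution on T), then f is an automorphism of A₁. -/

import Mathlib

noncomputable section

/-- `f : A → A` is a `K`-algebra endomorphism (as a bare function). -/
def IsAlgEndo (K : Type) [CommSemiring K] {A : Type} [Semiring A] [Algebra K A]
    (f : A → A) : Prop :=
  (∀ a b : A, f (a + b) = f a + f b) ∧
  (∀ (c : K) (a : A), f (c • a) = c • f a) ∧
  (∀ a b : A, f (a * b) = f a * f b) ∧ f 1 = 1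

/-- `f : A → A` is a `K`-algebra automorphism: a bijective endomorphism. -/
def IsAlgAuto (K : Type) [CommSemiring K] {A : Type} [Semiring A] [Algebra K A]
    (f : A → A) : Prop :=
  IsAlgEndo K f ∧ Function.Bijective f

/-- `f : A → A` is a `K`-linear anti-endomorphism. -/
def IsAntiEndo (K : Type) [CommSemiring K] {A : Type} [Semiring A] [Algebra K A]
    (f : A → A) : Prop :=
  (∀ a b : A, f (a + b) = f a + f b) ∧
  (∀ (c : K) (a : A), f (c • a) = c • f a) ∧
  (∀ a b : A, f (a * b) = f b * f a) ∧ f 1 = 1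

/-- `f : A → A` is an anti-automorphism: a bijective anti-endomorphism. -/
def IsAntiAuto (K : Type) [CommSemiring K] {A : Type} [Semiring A] [Algebra K A]
    (f : A → A) : Prop :=
  IsAntiEndo K f ∧ Function.Bijective f

/-- An involution on a `K`-algebra: an anti-automorphism of order at most two. -/
def IsInvolutionOn (K : Type) [CommSemiring K] {A : Type} [Semiring A] [Algebra K A]
    (γ : A → A) : Prop :=
  IsAntiAuto K γ ∧ γ ∘ γ = id

/-- The defining relation of the first Weyl algebra: `Y*X = X*Y + 1`. -/
inductive WeylRel (K : Type) [CommSemiring K] :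
    FreeAlgebra K (Fin 2) → FreeAlgebra K (Fin 2) → Prop
  | rel : WeylRel K (FreeAlgebra.ι K 1 * FreeAlgebra.ι K 0)
      (FreeAlgebra.ι K 0 * FreeAlgebra.ι K 1 + 1)

/-- The first Weyl algebra `A₁(K) = K⟨X,Y⟩/(YX - XY - 1)`. -/
abbrev Weyl (K : Type) [CommSemiring K] : Type := RingQuot (WeylRel K)

/-- The generator `X` of the Weyl algebra. -/
def Wx (K : Type) [CommSemiring K] : Weyl K :=
  RingQuot.mkAlgHom K (WeylRel K) (FreeAlgebra.ι K 0)

/-- The generator `Y` of the Weyl algebra. -/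
def Wy (K : Type) [CommSemiring K] : Weyl K :=
  RingQuot.mkAlgHom K (WeylRel K) (FreeAlgebra.ι K 1)

/-- `α` is the exchange involution: the involution with `α X = Y` and `α Y = X`. -/
def IsExchange (K : Type) [CommSemiring K] (α : Weyl K → Weyl K) : Prop :=
  IsInvolutionOn K α ∧ α (Wx K) = Wy K ∧ α (Wy K) = Wx K

/-- `γ` is conjugate to `α` by an automorphism or an anti-automorphism:
`γ = g⁻¹ ∘ α ∘ g`. -/
def ConjToAlpha (K : Type) [CommSemiring K] (α γ : Weyl K → Weyl K) : Prop :=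
  ∃ g : Weyl K → Weyl K, (IsAlgAuto K g ∨ IsAntiAuto K g) ∧
    γ = Function.invFun g ∘ α ∘ g


section
namespace WA
open Polynomial
set_option linter.all false

section basics
variable {R : Type} [CommRing R]

theorem rel : Wy R * Wx R = Wx R * Wy R + 1 := by
  have := RingQuot.mkAlgHom_rel R (WeylRel.rel (K := R))
  simpa [Wx, Wy] using this

def lift {B : Type} [Ring B] [Algebra R B] (u v : B) (h : v * u = u * v + 1) :
    Weyl R →ₐ[R] B :=
  RingQuot.liftAlgHom R ⟨FreeAlgebra.lift R ![u, v], by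
    rintro _ _ ⟨⟩
    simpa using h⟩

@[simp] theorem lift_x {B : Type} [Ring B] [Algebra R B] (u v : B) (h : v * u = u * v + 1) :
    lift (R := R) u v h (Wx R) = u := by
  simp [lift, Wx]

@[simp] theorem lift_y {B : Type} [Ring B] [Algebra R B] (u v : B) (h : v * u = u * v + 1) :
    lift (R := R) u v h (Wy R) = v := by
  simp [lift, Wy]

theorem adjoin_top : Algebra.adjoin R {Wx R, Wy R} = ⊤ := by
  have h1 : Algebra.adjoin R (Set.range (FreeAlgebra.ι R (X := Fin 2))) = ⊤ :=
    FreeAlgebra.adjoin_range_ι ..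
  have h2 := congrArg (Subalgebra.map (RingQuot.mkAlgHom R (WeylRel R))) h1
  rw [AlgHom.map_adjoin, Algebra.map_top,
    (AlgHom.range_eq_top _).2 (RingQuot.mkAlgHom_surjective R (WeylRel R))] at h2
  rw [← h2]
  congr 1
  ext a
  simp only [Set.mem_insert_iff, Set.mem_singleton_iff, Set.mem_image, Set.mem_range,
    exists_exists_eq_and, Fin.exists_fin_two, Wx, Wy]
  constructor
  · rintro (h | h)
    · exact ⟨_, Or.inl rfl, h.symm⟩
    · exact ⟨_, Or.inr rfl, h.symm⟩
  · rintro ⟨_, (rfl | rfl), h⟩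
    · exact Or.inl h.symm
    · exact Or.inr h.symm

/-- induction by left multiplication -/
theorem ind (N : Submodule R (Weyl R)) (h1 : 1 ∈ N) (hx : ∀ a ∈ N, Wx R * a ∈ N)
    (hy : ∀ a ∈ N, Wy R * a ∈ N) (a : Weyl R) : a ∈ N := by
  let U : Subalgebra R (Weyl R) :=
    { carrier := {a | ∀ n ∈ N, a * n ∈ N}
      mul_mem' := by
        intro a b ha hb n hn
        rw [mul_assoc]
        exact ha _ (hb _ hn)
      add_mem' := by
        intro a b ha hb n hn
        rw [add_mul]
        exact N.add_mem (ha _ hn) (hb _ hn)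
      algebraMap_mem' := by
        intro r n hn
        rw [← Algebra.smul_def]
        exact N.smul_mem _ hn }
  have hU : U = ⊤ := by
    rw [eq_top_iff, ← adjoin_top]
    refine Algebra.adjoin_le ?_
    rintro b (rfl | rfl)
    · exact hx
    · exact hy
  have : a ∈ U := by rw [hU]; trivial
  simpa using this 1 h1

theorem hom_ext {B : Type} [Ring B] [Algebra R B] {f g : Weyl R →ₐ[R] B}
    (hx : f (Wx R) = g (Wx R)) (hy : f (Wy R) = g (Wy R)) : f = g := by
  refine AlgHom.ext_of_adjoin_eq_top adjoin_top ?_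
  rintro b (rfl | rfl)
  · exact hx
  · exact hy

/-- the representation on symbols -/
def L : Weyl R →ₐ[R] Module.End R R[X][X] :=
  lift (LinearMap.mulLeft R (X : R[X][X]))
    (LinearMap.mulLeft R (C X : R[X][X]) + (derivative (R := R[X])).restrictScalars R) (by
      ext1 f
      simp only [Module.End.mul_apply, LinearMap.add_apply, LinearMap.mulLeft_apply,
        LinearMap.restrictScalars_apply, Module.End.one_apply, derivative_mul, derivative_X]
      ring)

def σ : Weyl R →ₗ[R] R[X][X] := LinearMap.applyₗ (1 : R[X][X]) ∘ₗ (L (R := R)).toLinearMap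

theorem σ_def (a : Weyl R) : σ a = L a 1 := rfl

theorem σ_mul (a b : Weyl R) : σ (a * b) = L a (σ b) := by
  simp [σ_def]

theorem σ_x_mul (a : Weyl R) : σ (Wx R * a) = X * σ a := by
  simp [σ_mul, L]

theorem σ_y_mul (a : Weyl R) : σ (Wy R * a) = C X * σ a + derivative (σ a) := by
  simp [σ_mul, L]

@[simp] theorem σ_one : σ (1 : Weyl R) = 1 := by simp [σ_def]

theorem σ_mul_y (a : Weyl R) : σ (a * Wy R) = C X * σ a := by
  let N : Submodule R (Weyl R) := LinearMap.ker
    (σ ∘ₗ LinearMap.mulRight R (Wy R) - LinearMap.mulLeft R (C X : R[X][X]) ∘ₗ σ)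
  have hN : ∀ a, a ∈ N ↔ σ (a * Wy R) = C X * σ a := by
    intro a
    simp [N, sub_eq_zero]
  rw [← hN]
  refine ind N ?_ ?_ ?_ a
  · rw [hN, one_mul, ← mul_one (Wy R), σ_y_mul]; simp
  · intro b hb
    rw [hN] at hb ⊢
    rw [mul_assoc, σ_x_mul, hb, σ_x_mul]; ring
  · intro b hb
    rw [hN] at hb ⊢
    rw [mul_assoc, σ_y_mul, hb, σ_y_mul]; simp; ring

theorem σ_y_pow (j : ℕ) : σ (Wy R ^ j) = C (X ^ j) := by
  induction j with
  | zero => simp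
  | succ n ih => rw [pow_succ, σ_mul_y, ih, ← C_mul]; ring_nf

theorem σ_x_pow_mul (i : ℕ) (a : Weyl R) : σ (Wx R ^ i * a) = X ^ i * σ a := by
  induction i with
  | zero => simp
  | succ n ih => rw [pow_succ', mul_assoc, σ_x_mul, ih]; ring

theorem σ_mono (i j : ℕ) : σ (Wx R ^ i * Wy R ^ j) = monomial i (monomial j (1 : R)) := by
  rw [σ_x_pow_mul, σ_y_pow, mul_comm, C_mul_X_pow_eq_monomial, X_pow_eq_monomial]

def mo (i j : ℕ) : Weyl R := Wx R ^ i * Wy R ^ j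

def ρ : R[X][X] →ₗ[R] Weyl R :=
  { toFun := fun f => f.sum fun i g => Wx R ^ i * aeval (Wy R) g
    map_add' := by
      intro f g
      rw [sum_add_index] <;> simp [mul_add]
    map_smul' := by
      intro r f
      rw [sum_smul_index'] <;> simp [Polynomial.sum, Finset.smul_sum] }

theorem ρ_mono (i : ℕ) (g : R[X]) : ρ (monomial i g) = Wx R ^ i * aeval (Wy R) g := by
  simp [ρ, sum_monomial_index]

theorem y_x_pow (i : ℕ) : Wy R * Wx R ^ i = Wx R ^ i * Wy R + i • Wx R ^ (i - 1) := by
  induction i with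
  | zero => simp
  | succ n ih =>
    rw [pow_succ, ← mul_assoc, ih, add_mul, mul_assoc, rel]
    rcases n with _ | n
    · simp
    · simp only [Nat.add_sub_cancel, smul_mul_assoc, ← pow_succ]
      rw [mul_add, add_assoc, ← mul_assoc, mul_one, add_smul _ 1]
      simp [add_comm, add_smul, add_assoc]
      rw [add_comm 1, pow_succ _ (n + 1)]

theorem ρ_X_mul (f : R[X][X]) : ρ (X * f) = Wx R * ρ f := by
  induction f using Polynomial.induction_on' with
  | add p q hp hq => rw [mul_add, map_add, hp, hq, map_add, mul_add]
  | monomial n a => rw [X_mul_monomial, ρ_mono, ρ_mono, pow_succ', mul_assoc]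

theorem ρ_Y_mul (f : R[X][X]) : ρ (C X * f + derivative f) = Wy R * ρ f := by
  induction f using Polynomial.induction_on' with
  | add p q hp hq =>
    have : C X * (p + q) + derivative (p + q)
        = (C X * p + derivative p) + (C X * q + derivative q) := by
      rw [derivative_add]; ring
    rw [this, map_add, hp, hq, map_add, mul_add]
  | monomial n a =>
    rw [C_mul_monomial, derivative_monomial, map_add, ρ_mono, ρ_mono, ρ_mono, ← mul_assoc,
      y_x_pow, add_mul, map_mul, aeval_X, mul_assoc]
    congr 1
    rw [map_mul, map_natCast, smul_mul_assoc, ← Nat.cast_comm, ← mul_assoc, ← Nat.cast_comm, nsmul_eq_mul, mul_assoc]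

theorem ρ_σ (a : Weyl R) : ρ (σ a) = a := by
  let N : Submodule R (Weyl R) := LinearMap.ker (ρ ∘ₗ σ - LinearMap.id)
  have hN : ∀ a, a ∈ N ↔ ρ (σ a) = a := by
    intro a
    simp [N, sub_eq_zero]
  rw [← hN]
  refine ind N ?_ ?_ ?_ a
  · rw [hN, σ_one, ← C_1, ← monomial_zero_left, ρ_mono]; simp
  · intro b hb
    rw [hN] at hb ⊢
    rw [σ_x_mul, ρ_X_mul, hb]
  · intro b hb
    rw [hN] at hb ⊢
    rw [σ_y_mul, ρ_Y_mul, hb]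

theorem σ_inj : Function.Injective (σ (R := R)) :=
  Function.LeftInverse.injective ρ_σ

/-- coefficients -/
def cf (a : Weyl R) (i j : ℕ) : R := ((σ a).coeff i).coeff j

theorem cf_ext {a b : Weyl R} (h : ∀ i j, cf a i j = cf b i j) : a = b := by
  apply σ_inj
  ext i j
  exact h i j

@[simp] theorem cf_add (a b : Weyl R) (i j : ℕ) : cf (a + b) i j = cf a i j + cf b i j := by
  simp [cf]
@[simp] theorem cf_sub (a b : Weyl R) (i j : ℕ) : cf (a - b) i j = cf a i j - cf b i j := by
  simp [cf]
@[simp] theorem cf_neg (a : Weyl R) (i j : ℕ) : cf (-a) i j = - cf a i j := by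
  simp [cf]
@[simp] theorem cf_smul (r : R) (a : Weyl R) (i j : ℕ) : cf (r • a) i j = r * cf a i j := by
  simp [cf]
@[simp] theorem cf_zero (i j : ℕ) : cf (0 : Weyl R) i j = 0 := by
  simp [cf]
theorem cf_sum {ι : Type} (s : Finset ι) (f : ι → Weyl R) (i j : ℕ) :
    cf (∑ k ∈ s, f k) i j = ∑ k ∈ s, cf (f k) i j := by
  simp [cf, finsetSum_coeff]
theorem cf_mo (i j i' j' : ℕ) : cf (mo i j : Weyl R) i' j' = if i = i' ∧ j = j' then 1 else 0 := by
  rw [cf, mo, σ_mono, coeff_monomial]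
  split_ifs with h1 h2 h2
  · rw [coeff_monomial, if_pos h2.2]
  · rw [coeff_monomial, if_neg (fun h => h2 ⟨h1, h⟩)]
  · exact absurd h2.1 h1
  · simp

theorem eq_sum (a : Weyl R) : ∃ N : ℕ, ∀ M, N ≤ M →
    a = ∑ i ∈ Finset.range M, ∑ j ∈ Finset.range M, cf a i j • mo i j := by
  refine ⟨(σ a).natDegree + 1 + ((σ a).support.sup fun i => ((σ a).coeff i).natDegree + 1), ?_⟩
  intro M hM
  apply cf_ext
  intro i j
  simp only [cf_sum, cf_smul, cf_mo, mul_ite, mul_one, mul_zero, ite_and]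
  rw [Finset.sum_comm]
  simp only [Finset.sum_ite_eq', Finset.mem_range]
  by_cases hi : i < M
  · by_cases hj : j < M
    · simp [hi, hj]
    · have : cf a i j = 0 := by
        apply coeff_eq_zero_of_natDegree_lt
        by_cases h : i ∈ (σ a).support
        · have := Finset.le_sup (f := fun i => ((σ a).coeff i).natDegree + 1) h
          omega
        · rw [notMem_support_iff.1 h, natDegree_zero]; omega
      simp [this]
  · have : cf a i j = 0 := by
      have h : (σ a).coeff i = 0 := coeff_eq_zero_of_natDegree_lt (by omega)
      rw [cf, h, coeff_zero]
    simp [this]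

/-- linear predicates can be checked on monomials -/
theorem ind_mo (N : Submodule R (Weyl R)) (h : ∀ i j, mo i j ∈ N) (a : Weyl R) : a ∈ N := by
  obtain ⟨M, hM⟩ := eq_sum a
  rw [hM M le_rfl]
  exact N.sum_mem fun i _ => N.sum_mem fun j _ => N.smul_mem _ (h i j)

end basics
end WA
end

section
namespace WA
open Polynomial
set_option linter.all false

section anti
variable {R : Type} [CommRing R]

def anti (u v : Weyl R) (h : u * v = v * u + 1) : Weyl R →ₗ[R] Weyl R :=
  (MulOpposite.opLinearEquiv R).symm.toLinearMap ∘ₗ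
    (lift (R := R) (B := (Weyl R)ᵐᵒᵖ) (MulOpposite.op u) (MulOpposite.op v) (by
      rw [← MulOpposite.op_mul, ← MulOpposite.op_mul, h]; rfl)).toLinearMap

theorem anti_mul (u v : Weyl R) (h : u * v = v * u + 1) (a b : Weyl R) :
    anti u v h (a * b) = anti u v h b * anti u v h a := by
  simp [anti]

theorem anti_one (u v : Weyl R) (h : u * v = v * u + 1) : anti u v h 1 = 1 := by
  simp [anti]

theorem anti_x (u v : Weyl R) (h : u * v = v * u + 1) : anti u v h (Wx R) = u := by
  simp [anti]

theorem anti_y (u v : Weyl R) (h : u * v = v * u + 1) : anti u v h (Wy R) = v := by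
  simp [anti]

theorem anti_pow (u v : Weyl R) (h : u * v = v * u + 1) (a : Weyl R) (n : ℕ) :
    anti u v h (a ^ n) = anti u v h a ^ n := by
  induction n with
  | zero => simp [anti_one]
  | succ n ih => rw [pow_succ, anti_mul, ih, pow_succ']

theorem anti_mo (u v : Weyl R) (h : u * v = v * u + 1) (i j : ℕ) :
    anti u v h (mo i j) = v ^ j * u ^ i := by
  rw [mo, anti_mul, anti_pow, anti_pow, anti_x, anti_y]

/-- exchange -/
def al : Weyl R →ₗ[R] Weyl R := anti (Wy R) (Wx R) rel

theorem al_mul (a b : Weyl R) : al (a * b) = al b * al a := anti_mul _ _ _ _ _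
@[simp] theorem al_one : al (1 : Weyl R) = 1 := anti_one _ _ _
@[simp] theorem al_x : al (Wx R) = Wy R := anti_x _ _ _
@[simp] theorem al_y : al (Wy R) = Wx R := anti_y _ _ _
theorem al_pow (a : Weyl R) (n : ℕ) : al (a ^ n) = al a ^ n := anti_pow _ _ _ _ _
theorem al_mo (i j : ℕ) : al (mo i j : Weyl R) = mo j i := anti_mo _ _ _ _ _

@[simp] theorem al_al (a : Weyl R) : al (al a) = a := by
  have h : a ∈ LinearMap.ker (al ∘ₗ al - (LinearMap.id : Weyl R →ₗ[R] Weyl R)) := by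
    apply ind_mo
    intro i j
    simp [al_mo]
  simpa [sub_eq_zero] using h

theorem cf_al (a : Weyl R) (i j : ℕ) : cf (al a) i j = cf a j i := by
  obtain ⟨M, hM⟩ := eq_sum a
  have h := hM M le_rfl
  rw [h]
  simp only [map_sum, map_smul, al_mo, cf_sum, cf_smul, cf_mo, and_comm]

/-- x fixed, y to -y -/
def st : Weyl R →ₗ[R] Weyl R := anti (Wx R) (-Wy R) (by rw [neg_mul (Wy R), rel]; simp; exact mul_neg (Wx R) (Wy R))

theorem st_mul (a b : Weyl R) : st (a * b) = st b * st a := anti_mul _ _ _ _ _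
theorem st_pow (a : Weyl R) (n : ℕ) : st (a ^ n) = st a ^ n := anti_pow _ _ _ _ _
@[simp] theorem st_one : st (1 : Weyl R) = 1 := anti_one _ _ _
@[simp] theorem st_x : st (Wx R) = Wx R := anti_x _ _ _
@[simp] theorem st_y : st (Wy R) = - Wy R := anti_y _ _ _
theorem st_mo (i j : ℕ) : st (mo i j : Weyl R) = (- Wy R) ^ j * Wx R ^ i := anti_mo _ _ _ _ _

end anti

section mapf
variable {R S : Type} [CommRing R] [CommRing S]

def map (φ : R →+* S) : Weyl R →+* Weyl S :=
  letI : Algebra R (Weyl S) := ((algebraMap S (Weyl S)).comp φ).toAlgebra' (by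
    intro c x
    exact Algebra.commutes (R := S) (A := Weyl S) _ _)
  (lift (R := R) (Wx S) (Wy S) rel).toRingHom

@[simp] theorem map_x (φ : R →+* S) : map φ (Wx R) = Wx S := by
  letI : Algebra R (Weyl S) := ((algebraMap S (Weyl S)).comp φ).toAlgebra' (by
    intro c x
    exact Algebra.commutes (R := S) (A := Weyl S) _ _)
  exact lift_x (R := R) (Wx S) (Wy S) rel

@[simp] theorem map_y (φ : R →+* S) : map φ (Wy R) = Wy S := by
  letI : Algebra R (Weyl S) := ((algebraMap S (Weyl S)).comp φ).toAlgebra' (by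
    intro c x
    exact Algebra.commutes (R := S) (A := Weyl S) _ _)
  exact lift_y (R := R) (Wx S) (Wy S) rel

theorem map_algebraMap (φ : R →+* S) (r : R) :
    map φ (algebraMap R _ r) = algebraMap S _ (φ r) := by
  letI : Algebra R (Weyl S) := ((algebraMap S (Weyl S)).comp φ).toAlgebra' (by
    intro c x
    exact Algebra.commutes (R := S) (A := Weyl S) _ _)
  exact (lift (R := R) (Wx S) (Wy S) rel).commutes r

theorem map_smul' (φ : R →+* S) (r : R) (a : Weyl R) :
    map φ (r • a) = φ r • map φ a := by
  rw [Algebra.smul_def, map_mul, map_algebraMap, ← Algebra.smul_def]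

theorem map_mo (φ : R →+* S) (i j : ℕ) : map φ (mo i j) = mo i j := by
  simp [mo]

theorem cf_map (φ : R →+* S) (a : Weyl R) (i j : ℕ) : cf (map φ a) i j = φ (cf a i j) := by
  obtain ⟨M, hM⟩ := eq_sum a
  have h := hM M le_rfl
  rw [h]
  simp only [map_sum, map_smul', map_mo, cf_sum, cf_smul, cf_mo, map_mul]
  simp

theorem map_injective (φ : R →+* S) (h : Function.Injective φ) : Function.Injective (map φ) := by
  intro a b hab
  apply cf_ext
  intro i j
  apply h
  rw [← cf_map, ← cf_map, hab]

theorem map_st (φ : R →+* S) (a : Weyl R) : map φ (st a) = st (map φ a) := by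
  obtain ⟨M, hM⟩ := eq_sum a
  have h := hM M le_rfl
  rw [h]
  simp only [map_sum, map_smul', map_mo, st_mo, map_smul]
  simp

theorem mem_range_map (φ : R →+* S) (a : Weyl S) (h : ∀ i j, ∃ r, φ r = cf a i j) :
    ∃ b, map φ b = a := by
  choose r hr using h
  obtain ⟨M, hM⟩ := eq_sum a
  refine ⟨∑ i ∈ Finset.range M, ∑ j ∈ Finset.range M, r i j • mo i j, ?_⟩
  rw [hM M le_rfl]
  simp only [map_sum, map_smul', map_mo, hr]

theorem exists_of_map_zero (φ : R →+* S) (q : R) (h : ∀ r, φ r = 0 → ∃ w, r = q * w) (a : Weyl R)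
    (ha : map φ a = 0) : ∃ b, a = q • b := by
  have : ∀ i j, ∃ w, cf a i j = q * w := by
    intro i j
    apply h
    rw [← cf_map, ha, cf_zero]
  choose w hw using this
  obtain ⟨M, hM⟩ := eq_sum a
  refine ⟨∑ i ∈ Finset.range M, ∑ j ∈ Finset.range M, w i j • mo i j, ?_⟩
  conv_lhs => rw [hM M le_rfl]
  simp only [Finset.smul_sum, hw, mul_smul]

theorem smul_cancel (q : R) (h : ∀ r, q * r = 0 → r = 0) (a : Weyl R) (ha : q • a = 0) : a = 0 := by
  apply cf_ext
  intro i j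
  rw [cf_zero]
  apply h
  rw [← cf_smul, ha, cf_zero]

end mapf

section deg
variable {R : Type} [CommRing R]

theorem L_mul_apply (a b : Weyl R) (g : R[X][X]) : L (a * b) g = L a (L b g) := by simp

theorem L_x (g : R[X][X]) : L (Wx R) g = X * g := by simp [L]
theorem L_y (g : R[X][X]) : L (Wy R) g = C X * g + derivative g := by simp [L]

theorem L_x_pow (i : ℕ) (g : R[X][X]) : L (Wx R ^ i) g = X ^ i * g := by
  induction i with
  | zero => simp
  | succ n ih => rw [pow_succ', L_mul_apply, ih, L_x]; ring

theorem L_y_pow (j n : ℕ) (g : R[X][X]) (hg : ∀ k, n < k → g.coeff k = 0) :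
    (∀ k, n < k → (L (Wy R ^ j) g).coeff k = 0) ∧
      ∀ k, n ≤ k → (L (Wy R ^ j) g).coeff k = X ^ j * g.coeff k := by
  induction j with
  | zero => simpa using hg
  | succ j ih =>
    have : ∀ k, n ≤ k → (L (Wy R ^ (j + 1)) g).coeff k = X ^ (j + 1) * g.coeff k := by
      intro k hk
      rw [pow_succ', L_mul_apply, L_y, coeff_add, coeff_C_mul, coeff_derivative, ih.2 k hk,
        ih.1 (k + 1) (by omega)]
      ring
    refine ⟨?_, this⟩
    intro k hk
    rw [this k hk.le, hg k hk, mul_zero]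

theorem σ_mul_coeff (a b : Weyl R) (m n : ℕ) (ha : ∀ k, m < k → (σ a).coeff k = 0)
    (hb : ∀ k, n < k → (σ b).coeff k = 0) (k : ℕ) (hk : m + n ≤ k) :
    (σ (a * b)).coeff k = (σ a * σ b).coeff k := by
  obtain ⟨M, hM⟩ := eq_sum a
  have h := hM M le_rfl
  have key : ∀ i j, i ≤ m → (σ (mo i j * b)).coeff k = (σ (mo i j : Weyl R) * σ b).coeff k := by
    intro i j hi
    obtain ⟨i', rfl⟩ : ∃ i', k = i' + i := ⟨k - i, by omega⟩
    rw [mo, mul_assoc, σ_x_pow_mul, σ_x_pow_mul, σ_mul, σ_y_pow, mul_assoc,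
      coeff_X_pow_mul, coeff_X_pow_mul, coeff_C_mul]
    exact (L_y_pow j n _ hb).2 i' (by omega)
  conv_lhs => rw [h]
  conv_rhs => rw [h]
  simp only [Finset.sum_mul, map_sum, finsetSum_coeff, smul_mul_assoc, map_smul, coeff_smul]
  refine Finset.sum_congr rfl fun i _ => Finset.sum_congr rfl fun j _ => ?_
  by_cases hi : i ≤ m
  · rw [key i j hi]
  · have : cf a i j = 0 := by rw [cf, ha i (by omega), coeff_zero]
    simp [this]

theorem σ_mul_coeff_top (a b : Weyl R) (m n : ℕ) (ha : ∀ k, m < k → (σ a).coeff k = 0)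
    (hb : ∀ k, n < k → (σ b).coeff k = 0) :
    (∀ k, m + n < k → (σ (a * b)).coeff k = 0) ∧
    (σ (a * b)).coeff (m + n) = (σ a).coeff m * (σ b).coeff n := by
  have h1 : (σ a).natDegree ≤ m := natDegree_le_iff_coeff_eq_zero.2 ha
  have h2 : (σ b).natDegree ≤ n := natDegree_le_iff_coeff_eq_zero.2 hb
  constructor
  · intro k hk
    rw [σ_mul_coeff a b m n ha hb k hk.le]
    exact coeff_eq_zero_of_natDegree_lt (lt_of_le_of_lt (natDegree_mul_le_of_le h1 h2) hk)
  · rw [σ_mul_coeff a b m n ha hb _ le_rfl, coeff_mul_add_eq_of_natDegree_le h1 h2]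

theorem σ_pow_coeff_top (a : Weyl R) (m n : ℕ) (ha : ∀ k, m < k → (σ a).coeff k = 0) :
    (∀ k, n * m < k → (σ (a ^ n)).coeff k = 0) ∧
    (σ (a ^ n)).coeff (n * m) = (σ a).coeff m ^ n := by
  induction n with
  | zero =>
    refine ⟨?_, by simp⟩
    intro k hk
    rw [pow_zero, σ_one, coeff_one, if_neg (by omega)]
  | succ n ih =>
    have := σ_mul_coeff_top (a ^ n) a (n * m) m ih.1 ha
    rw [pow_succ, add_mul, one_mul, this.2, ih.2, pow_succ]
    exact ⟨this.1, rfl⟩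

instance [IsDomain R] : NoZeroDivisors (Weyl R) := by
  constructor
  intro a b hab
  by_contra! hne
  have h1 : σ a ≠ 0 := fun h => hne.1 (σ_inj (by rw [h, map_zero]))
  have h2 : σ b ≠ 0 := fun h => hne.2 (σ_inj (by rw [h, map_zero]))
  have := (σ_mul_coeff_top a b _ _ (fun k => coeff_eq_zero_of_natDegree_lt)
    (fun k => coeff_eq_zero_of_natDegree_lt)).2
  rw [hab, map_zero, coeff_zero] at this
  rcases mul_eq_zero.1 this.symm with h | h
  · exact h1 (leadingCoeff_eq_zero.1 h)
  · exact h2 (leadingCoeff_eq_zero.1 h)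

def dx (a : Weyl R) : ℕ := (σ a).natDegree
def dy (a : Weyl R) : ℕ := dx (al a)

theorem cf_dx (a : Weyl R) (i j : ℕ) (h : dx a < i) : cf a i j = 0 := by
  rw [cf, coeff_eq_zero_of_natDegree_lt h, coeff_zero]
theorem cf_dy (a : Weyl R) (i j : ℕ) (h : dy a < j) : cf a i j = 0 := by
  rw [← cf_al, cf_dx _ _ _ h]

theorem cf_pow_dx (a : Weyl R) (n i j : ℕ) (h : n * dx a < i) : cf (a ^ n) i j = 0 := by
  rw [cf, (σ_pow_coeff_top a (dx a) n fun k => coeff_eq_zero_of_natDegree_lt).1 i h, coeff_zero]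
theorem cf_pow_dy (a : Weyl R) (n i j : ℕ) (h : n * dy a < j) : cf (a ^ n) i j = 0 := by
  rw [← cf_al, al_pow, cf_pow_dx _ _ _ _ h]

theorem cf_comm_y (a : Weyl R) (i j : ℕ) :
    cf (Wy R * a - a * Wy R) i j = cf a (i + 1) j * (i + 1) := by
  simp only [cf, map_sub, σ_y_mul, σ_mul_y, add_sub_cancel_left, coeff_derivative]
  have : ((i : R[X]) + 1) = ((i + 1 : ℕ) : R[X]) := by push_cast; rfl
  rw [this, coeff_mul_natCast]
  simp

theorem cf_comm_x (a : Weyl R) (i j : ℕ) :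
    cf (a * Wx R - Wx R * a) i j = cf a i (j + 1) * (j + 1) := by
  rw [← cf_al, map_sub, al_mul, al_mul, al_x, cf_comm_y, cf_al]

end deg
end WA
end

section
namespace WA
open Polynomial
set_option linter.all false

section abst
variable {A : Type} [Ring A]

theorem abs_t_spow (S T : A) (h : T * S = S * T + 1) (i : ℕ) :
    T * S ^ i = S ^ i * T + i * S ^ (i - 1) := by
  induction i with
  | zero => simp
  | succ n ih =>
    rw [pow_succ, ← mul_assoc, ih, add_mul, mul_assoc, h]
    rcases n with _ | n
    · simp
    · simp only [Nat.add_sub_cancel, mul_assoc, ← pow_succ]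
      rw [mul_add, add_assoc, ← mul_assoc, mul_one, pow_succ]
      push_cast
      noncomm_ring

theorem abs_tpow_s (S T : A) (h : T * S = S * T + 1) (i : ℕ) :
    T ^ i * S = S * T ^ i + i * T ^ (i - 1) := by
  have := abs_t_spow T (-S) (by rw [neg_mul, mul_neg, h]; abel) i
  have h2 : (-S) * T ^ i = -(S * T ^ i) := by noncomm_ring
  have h3 : T ^ i * (-S) = -(T ^ i * S) := by noncomm_ring
  rw [h2, h3] at this
  have : -(S * T ^ i) + T ^ i * S = i * T ^ (i - 1) := by rw [this]; abel
  rw [← this]; abel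

theorem abs_indep (S T : A) (h : T * S = S * T + 1) (p : ℕ)
    (hp : ∀ n : ℕ, 0 < n → n < p → ∀ a : A, (n : A) * a = 0 → a = 0)
    (n : ℕ) (hn : n ≤ p) (a : ℕ → A) (ha : ∀ i, T * a i = a i * T)
    (h0 : ∑ i ∈ Finset.range n, S ^ i * a i = 0) : ∀ i < n, a i = 0 := by
  induction n generalizing a with
  | zero => intro i hi; omega
  | succ n ih =>
    have key : ∑ i ∈ Finset.range n, S ^ i * (((i + 1 : ℕ) : A) * a (i + 1)) = 0 := by
      have h1 : T * (∑ i ∈ Finset.range (n + 1), S ^ i * a i)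
          - (∑ i ∈ Finset.range (n + 1), S ^ i * a i) * T = 0 := by rw [h0]; simp
      rw [Finset.mul_sum, Finset.sum_mul, ← Finset.sum_sub_distrib] at h1
      have h2 : ∀ i, T * (S ^ i * a i) - S ^ i * a i * T = i * S ^ (i - 1) * a i := by
        intro i
        rw [← mul_assoc, abs_t_spow S T h, add_mul, mul_assoc, ha, mul_assoc]
        noncomm_ring
      simp only [h2] at h1
      rw [Finset.sum_range_succ'] at h1
      simp only [Nat.cast_zero, zero_mul, add_zero, Nat.add_sub_cancel] at h1
      rw [← h1]
      refine Finset.sum_congr rfl fun i _ => ?_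
      rw [← mul_assoc, Nat.cast_comm]
    have h3 := ih (by omega) (fun i => ((i + 1 : ℕ) : A) * a (i + 1)) (by
      intro i
      rw [mul_assoc, ← ha, ← mul_assoc, ← mul_assoc, ← Nat.cast_comm]) key
    have h4 : ∀ i < n, a (i + 1) = 0 := by
      intro i hi
      exact hp (i + 1) (by omega) (by omega) _ (h3 i hi)
    intro i hi
    rcases i with _ | i
    · rw [Finset.sum_range_succ'] at h0
      rw [Finset.sum_eq_zero] at h0
      · simpa using h0
      · intro i hi
        rw [h4 i (Finset.mem_range.1 hi), mul_zero]
    · exact h4 i (by omega)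

theorem abs_indep2 (S T : A) (h : T * S = S * T + 1) (p : ℕ)
    (hp : ∀ n : ℕ, 0 < n → n < p → ∀ a : A, (n : A) * a = 0 → a = 0)
    (z : ℕ → ℕ → A) (hz : ∀ i j a, z i j * a = a * z i j)
    (h0 : ∑ i ∈ Finset.range p, ∑ j ∈ Finset.range p, S ^ i * (T ^ j * z i j) = 0) :
    ∀ i < p, ∀ j < p, z i j = 0 := by
  intro i hi
  have h1 := abs_indep S T h p hp p le_rfl (fun i => ∑ j ∈ Finset.range p, T ^ j * z i j) (by
    intro i
    rw [Finset.mul_sum, Finset.sum_mul]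
    refine Finset.sum_congr rfl fun j _ => ?_
    rw [mul_assoc, hz, ← mul_assoc, ← mul_assoc, (Commute.self_pow T j).eq]) (by
      simpa only [Finset.mul_sum] using h0) i hi
  exact abs_indep T (-S) (by rw [neg_mul, mul_neg, h]; abel) p hp p le_rfl (z i)
    (fun j => (hz _ _ _).symm) h1

theorem abs_central [NoZeroDivisors A] [Nontrivial A] (S T : A) (h : T * S = S * T + 1) (p : ℕ)
    (hp : ∀ n : ℕ, 0 < n → n < p → ∀ a : A, (n : A) * a = 0 → a = 0) (hp0 : (p : A) = 0)
    (w : Finset A) (hw : w.card ≤ p * p)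
    (hs : Submodule.span (Subring.center A) (w : Set A) = ⊤) (a : A) :
    T ^ p * a = a * T ^ p := by
  haveI : IsDomain A := NoZeroDivisors.to_isDomain A
  let v : Option (Fin p × Fin p) → A := fun o => o.elim a fun q => S ^ (q.1 : ℕ) * T ^ (q.2 : ℕ)
  have hv : ¬ LinearIndependent (Subring.center A) v := by
    intro hv
    have := linearIndependent_le_span_finset v hv w hs
    simp only [Cardinal.mk_fintype, Fintype.card_option, Fintype.card_prod, Fintype.card_fin] at this
    have := Nat.cast_le.1 this
    omega
  rw [Fintype.not_linearIndependent_iff] at hv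
  obtain ⟨g, hg, o, ho⟩ := hv
  rw [Fintype.sum_option] at hg
  have hcen : ∀ (z : Subring.center A) (b : A), (z : A) * b = b * z := fun z b =>
    (Subring.mem_center_iff.1 z.2 b).symm
  let z : ℕ → ℕ → A := fun i j => if h : i < p ∧ j < p then (g (some (⟨i, h.1⟩, ⟨j, h.2⟩)) : A) else 0
  have hz : ∀ i j b, z i j * b = b * z i j := by
    intro i j b
    simp only [z]
    split_ifs
    · exact hcen _ _
    · simp
  have hsum : ∑ q : Fin p × Fin p, g (some q) • v (some q)
      = ∑ i ∈ Finset.range p, ∑ j ∈ Finset.range p, S ^ i * (T ^ j * z i j) := by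
    rw [Fintype.sum_prod_type, Finset.sum_range]
    refine Finset.sum_congr rfl fun i _ => ?_
    rw [Finset.sum_range]
    refine Finset.sum_congr rfl fun j _ => ?_
    simp only [z, v, i.2, j.2, Option.elim, dite_true, and_self]
    rw [← mul_assoc, ← hcen]; rfl
  have hne : (g none : A) ≠ 0 := by
    intro h0
    have h0' : g none = 0 := Subtype.ext h0
    rw [h0', zero_smul, zero_add, hsum] at hg
    have := abs_indep2 S T h p hp z hz hg
    apply ho
    rcases o with _ | ⟨i, j⟩
    · exact h0'
    · have := this i i.2 j j.2
      simp only [z, i.2, j.2, and_self, dite_true] at this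
      exact Subtype.ext this
  have hTS : Commute (T ^ p) S := by
    have := abs_tpow_s S T h p
    rw [hp0, zero_mul, add_zero] at this
    exact this
  have hTT : Commute (T ^ p) T := (Commute.refl T).pow_left p
  have hc : Commute (T ^ p) (∑ q : Fin p × Fin p, g (some q) • v (some q)) := by
    rw [hsum]
    refine Commute.sum_right _ _ _ fun i _ => Commute.sum_right _ _ _ fun j _ => ?_
    exact (hTS.pow_right i).mul_right ((hTT.pow_right j).mul_right (hz _ _ _).symm)
  have hga : (g none : A) * a = - ∑ q : Fin p × Fin p, g (some q) • v (some q) :=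
    eq_neg_of_add_eq_zero_left hg
  have hc2 : Commute (T ^ p) ((g none : A) * a) := by rw [hga]; exact hc.neg_right
  have : (g none : A) * (T ^ p * a - a * T ^ p) = 0 := by
    rw [mul_sub, ← mul_assoc, hcen, mul_assoc, hcen, ← mul_assoc (g none : A), ← hc2.eq,
      hcen, sub_self]
  exact sub_eq_zero.1 ((mul_eq_zero.1 this).resolve_left hne)

end abst
end WA
end

section
namespace WA
open Polynomial
set_option linter.all false

section charp
variable {k : Type} [Field k] (p : ℕ) [Fact p.Prime] [CharP k p]

instance : Nontrivial (Weyl k) := ⟨⟨0, 1, fun h => by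
  have := congrArg σ h
  simp at this⟩⟩

theorem W_char0 : ((p : ℕ) : Weyl k) = 0 := by
  rw [← map_natCast (algebraMap k (Weyl k)), CharP.cast_eq_zero, map_zero]

theorem W_char (n : ℕ) (h0 : 0 < n) (hn : n < p) (a : Weyl k) (h : (n : Weyl k) * a = 0) :
    a = 0 := by
  rcases mul_eq_zero.1 h with h | h
  · exfalso
    rw [← map_natCast (algebraMap k (Weyl k)), Algebra.algebraMap_eq_smul_one] at h
    have := congrArg σ h
    rw [map_smul, σ_one, map_zero] at this
    have h2 : (n : k) = 0 := by
      rcases smul_eq_zero.1 this with h | h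
      · exact h
      · exact absurd h one_ne_zero
    rw [CharP.cast_eq_zero_iff k p] at h2
    exact absurd (Nat.le_of_dvd h0 h2) (by omega)
  · exact h

theorem comm_top (a : Weyl k) (h1 : a * Wx k = Wx k * a) (h2 : a * Wy k = Wy k * a) (b : Weyl k) :
    a * b = b * a := by
  have hb : b ∈ Algebra.adjoin k {Wx k, Wy k} := by rw [adjoin_top]; trivial
  induction hb using Algebra.adjoin_induction with
  | mem x hx =>
    rcases hx with rfl | rfl
    · exact h1
    · exact h2
  | algebraMap r => exact (Algebra.commutes r a).symm
  | add x y _ _ hx hy => rw [mul_add, add_mul, hx, hy]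
  | mul x y _ _ hx hy => rw [← mul_assoc, hx, mul_assoc, hy, mul_assoc]

theorem xp_central (a : Weyl k) : Wx k ^ p * a = a * Wx k ^ p := by
  apply comm_top
  · exact (Commute.pow_self _ _).eq
  · have := abs_t_spow (Wx k) (Wy k) rel p
    rw [W_char0, zero_mul, add_zero] at this
    exact this.symm

theorem yp_central (a : Weyl k) : Wy k ^ p * a = a * Wy k ^ p := by
  apply comm_top
  · have := abs_tpow_s (Wx k) (Wy k) rel p
    rw [W_char0, zero_mul, add_zero] at this
    exact this
  · exact (Commute.pow_self _ _).eq

theorem W_span : ∃ w : Finset (Weyl k), w.card ≤ p * p ∧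
    Submodule.span (Subring.center (Weyl k)) (w : Set (Weyl k)) = ⊤ := by
  classical
  refine ⟨(Finset.range p ×ˢ Finset.range p).image fun q => mo q.1 q.2, ?_, ?_⟩
  · exact Finset.card_image_le.trans (by simp)
  rw [eq_top_iff]
  rintro a -
  set V := Submodule.span (Subring.center (Weyl k))
    (((Finset.range p ×ˢ Finset.range p).image fun q => (mo q.1 q.2 : Weyl k) : Finset (Weyl k)) :
      Set (Weyl k)) with hV
  have hp : 0 < p := (Fact.out : p.Prime).pos
  have hmo : ∀ i j, (mo i j : Weyl k) ∈ V := by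
    intro i j
    have hc : (Wx k ^ p) ^ (i / p) * (Wy k ^ p) ^ (j / p) ∈ Subring.center (Weyl k) := by
      refine mul_mem (pow_mem ?_ _) (pow_mem ?_ _)
      · exact Subring.mem_center_iff.2 fun g => (xp_central p g).symm
      · exact Subring.mem_center_iff.2 fun g => (yp_central p g).symm
    have h1 : (mo i j : Weyl k) = (⟨_, hc⟩ : Subring.center (Weyl k)) • mo (i % p) (j % p) := by
      change mo i j = ((Wx k ^ p) ^ (i / p) * (Wy k ^ p) ^ (j / p)) * mo (i % p) (j % p)
      have h2 : (Wy k ^ p) ^ (j / p) * Wx k ^ (i % p) = Wx k ^ (i % p) * (Wy k ^ p) ^ (j / p) :=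
        ((show Commute (Wy k ^ p) (Wx k ^ (i % p)) from yp_central p _).pow_left _).eq
      rw [mo, mo, mul_assoc, ← mul_assoc _ (Wx k ^ (i % p)), h2, mul_assoc, ← pow_mul, ← pow_mul, ← pow_add,
        ← mul_assoc, ← pow_add, Nat.div_add_mod, Nat.div_add_mod]
    rw [h1]
    refine V.smul_mem _ (Submodule.subset_span ?_)
    simp only [Finset.coe_image, Set.mem_image]
    exact ⟨(i % p, j % p), by simp [Nat.mod_lt _ hp], rfl⟩
  obtain ⟨M, hM⟩ := eq_sum a
  rw [hM M le_rfl]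
  refine V.sum_mem fun i _ => V.sum_mem fun j _ => ?_
  have hc : algebraMap k (Weyl k) (cf a i j) ∈ Subring.center (Weyl k) :=
    Subring.mem_center_iff.2 fun g => (Algebra.commutes _ g).symm
  rw [Algebra.smul_def]
  exact V.smul_mem ⟨_, hc⟩ (hmo i j)

theorem Tp_central (S T : Weyl k) (h : T * S = S * T + 1) (a : Weyl k) :
    T ^ p * a = a * T ^ p := by
  obtain ⟨w, hw, hs⟩ := W_span (k := k) p
  exact abs_central S T h p (W_char p) (W_char0 p) w hw hs a

theorem Sp_central (S T : Weyl k) (h : T * S = S * T + 1) (a : Weyl k) :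
    S ^ p * a = a * S ^ p := by
  refine Tp_central p (-T) S ?_ a
  have h1 : S * (-T) = -(S * T) := mul_neg S T
  have h2 : (-T) * S = - (T * S) := neg_mul T S
  rw [h1, h2, h]; abel

/-- the central embedding, bivariate polynomials with outer variable x^p -/
def ce : MvPolynomial (Fin 2) k →ₗ[k] Weyl k :=
  (MvPolynomial.basisMonomials (Fin 2) k).constr k fun m => (mo (p * m 0) (p * m 1) : Weyl k)

theorem ce_mono (m : Fin 2 →₀ ℕ) (r : k) :
    ce p (MvPolynomial.monomial m r) = r • (mo (p * m 0) (p * m 1) : Weyl k) := by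
  have : MvPolynomial.monomial m r = r • MvPolynomial.basisMonomials (Fin 2) k m := by
    simp [MvPolynomial.smul_monomial]
  rw [this, map_smul, ce, Module.Basis.constr_basis]

theorem mo_p_mul (i j i' j' : ℕ) : (mo (p * i) (p * j) * mo (p * i') (p * j') : Weyl k)
    = mo (p * (i + i')) (p * (j + j')) := by
  have h2 : (Wy k ^ p) ^ j * (Wx k ^ p) ^ i' = (Wx k ^ p) ^ i' * (Wy k ^ p) ^ j :=
        ((show Commute (Wy k ^ p) ((Wx k ^ p) ^ i') from yp_central p _).pow_left _).eq
  simp only [mo, pow_mul]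
  rw [mul_assoc, ← mul_assoc _ ((Wx k ^ p) ^ i'), h2, mul_assoc, ← pow_add, ← mul_assoc, ← pow_add]

theorem ce_mul (f g : MvPolynomial (Fin 2) k) : ce p (f * g) = ce p f * ce p g := by
  induction f using MvPolynomial.induction_on' with
  | add f1 f2 h1 h2 => rw [add_mul, map_add, map_add, h1, h2, add_mul]
  | monomial m r =>
    induction g using MvPolynomial.induction_on' with
    | add f1 f2 h1 h2 => rw [mul_add, map_add, map_add, h1, h2, mul_add]
    | monomial n s =>
      rw [MvPolynomial.monomial_mul, ce_mono, ce_mono, ce_mono, smul_mul_assoc, mul_smul_comm,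
        mo_p_mul, smul_smul]
      rfl

theorem ce_one : ce p (1 : MvPolynomial (Fin 2) k) = 1 := by
  rw [← MvPolynomial.C_1, ← MvPolynomial.monomial_zero', ce_mono]
  simp [mo]

def ex (i j : ℕ) : Fin 2 →₀ ℕ := Finsupp.equivFunOnFinite.symm ![i, j]

@[simp] theorem ex0 (i j : ℕ) : ex i j 0 = i := rfl
@[simp] theorem ex1 (i j : ℕ) : ex i j 1 = j := rfl

theorem ex_ext (m n : Fin 2 →₀ ℕ) (h0 : m 0 = n 0) (h1 : m 1 = n 1) : m = n := by
  ext i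
  fin_cases i
  · exact h0
  · exact h1

theorem cf_ce (f : MvPolynomial (Fin 2) k) (i j : ℕ) :
    cf (ce p f) (p * i) (p * j) = f.coeff (ex i j) := by
  have hp : p ≠ 0 := (Fact.out : p.Prime).ne_zero
  induction f using MvPolynomial.induction_on' with
  | add f1 f2 h1 h2 => rw [map_add, cf_add, h1, h2, MvPolynomial.coeff_add]
  | monomial m r =>
    classical
    rw [ce_mono, cf_smul, cf_mo, MvPolynomial.coeff_monomial]
    have : (p * m 0 = p * i ∧ p * m 1 = p * j) ↔ m = ex i j := by
      constructor
      · rintro ⟨h0, h1⟩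
        exact ex_ext _ _ (mul_left_cancel₀ hp h0) (mul_left_cancel₀ hp h1)
      · rintro rfl; simp
    simp only [this, mul_ite, mul_one, mul_zero]

theorem ce_inj : Function.Injective (ce (k := k) p) := by
  intro f g h
  ext m
  have : m = ex (m 0) (m 1) := ex_ext _ _ rfl rfl
  rw [this, ← cf_ce p, ← cf_ce p, h]

theorem ce_X0 : ce p (MvPolynomial.X 0 : MvPolynomial (Fin 2) k) = Wx k ^ p := by
  rw [MvPolynomial.X, ce_mono]
  simp [mo]
theorem ce_X1 : ce p (MvPolynomial.X 1 : MvPolynomial (Fin 2) k) = Wy k ^ p := by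
  rw [MvPolynomial.X, ce_mono]
  simp [mo]
theorem ce_C (r : k) : ce p (MvPolynomial.C r : MvPolynomial (Fin 2) k) = algebraMap k _ r := by
  rw [← MvPolynomial.monomial_zero', ce_mono]
  simp [mo, Algebra.algebraMap_eq_smul_one]

theorem central_ce (a : Weyl k) (h : ∀ b, a * b = b * a) : ∃ f, ce p f = a := by
  have h1 : ∀ i j, ¬ (p ∣ i ∧ p ∣ j) → cf a i j = 0 := by
    intro i j hij
    by_cases hi : p ∣ i
    · have hj : ¬ p ∣ j := fun hj => hij ⟨hi, hj⟩
      obtain ⟨j, rfl⟩ : ∃ j', j = j' + 1 := Nat.exists_eq_succ_of_ne_zero (by rintro rfl; simp at hj)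
      have := cf_comm_x a i j
      rw [h, sub_self, cf_zero] at this
      rcases mul_eq_zero.1 this.symm with h | h
      · exact h
      · exfalso; apply hj
        rw [← CharP.cast_eq_zero_iff k p]; exact_mod_cast h
    · obtain ⟨i, rfl⟩ : ∃ j', i = j' + 1 := Nat.exists_eq_succ_of_ne_zero (by rintro rfl; simp at hi)
      have := cf_comm_y a i j
      rw [h, sub_self, cf_zero] at this
      rcases mul_eq_zero.1 this.symm with h | h
      · exact h
      · exfalso; apply hi
        rw [← CharP.cast_eq_zero_iff k p]; exact_mod_cast h
  obtain ⟨M, hM⟩ := eq_sum a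
  have : a ∈ LinearMap.range (ce (k := k) p) := by
    rw [hM M le_rfl]
    refine Submodule.sum_mem _ fun i _ => Submodule.sum_mem _ fun j _ => ?_
    by_cases hij : p ∣ i ∧ p ∣ j
    · obtain ⟨⟨i, rfl⟩, ⟨j, rfl⟩⟩ := hij
      refine Submodule.smul_mem _ _ ⟨MvPolynomial.monomial (ex i j) 1, ?_⟩
      rw [ce_mono]; simp
    · rw [h1 i j hij, zero_smul]; exact Submodule.zero_mem _
  exact this

theorem st_ce (f : MvPolynomial (Fin 2) k) (i j : ℕ) :
    cf (st (ce p f)) (p * i) (p * j) = (-1) ^ (p * j) * f.coeff (ex i j) := by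
  rw [← cf_ce p]
  have key : ∀ i' j', st (mo (p * i') (p * j') : Weyl k) = ((-1 : k) ^ (p * j')) • mo (p * i') (p * j') := by
    intro i' j'
    have h1 : (- Wy k) ^ (p * j') = ((-1 : k) ^ (p * j')) • Wy k ^ (p * j') := by
      have : (- Wy k) = (-1 : k) • Wy k := (neg_one_smul k (Wy k)).symm
      rw [this, _root_.smul_pow]
    have h2 : Wy k ^ (p * j') * Wx k ^ (p * i') = Wx k ^ (p * i') * Wy k ^ (p * j') := by
      rw [pow_mul]
      exact ((show Commute (Wy k ^ p) (Wx k ^ (p * i')) from yp_central p _).pow_left _).eq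
    rw [st_mo, h1, smul_mul_assoc, h2, mo]
  induction f using MvPolynomial.induction_on' with
  | add f1 f2 h1 h2 => rw [map_add, map_add, cf_add, h1, h2, cf_add, mul_add]
  | monomial m r =>
    rw [ce_mono, map_smul, cf_smul, key, cf_smul]
    rw [cf_smul, cf_mo]
    split_ifs with h
    · rw [h.2]; ring
    · simp

end charp
end WA
end

section
namespace WA
open Polynomial
set_option linter.all false

section abst
variable {A : Type} [Ring A]

theorem abs_ad (S T : A) (h : T * S = S * T + 1) (m j : ℕ) :
    ((LinearMap.mulLeft ℤ T - LinearMap.mulRight ℤ T) ^ j : Module.End ℤ A) (S ^ m)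
      = (m.descFactorial j : A) * S ^ (m - j) := by
  induction j with
  | zero => simp
  | succ j ih =>
    rw [pow_succ', Module.End.mul_apply, ih]
    simp only [LinearMap.sub_apply, LinearMap.mulLeft_apply, LinearMap.mulRight_apply]
    rw [← mul_assoc, ← Nat.cast_comm, mul_assoc, mul_assoc, ← mul_sub, abs_t_spow S T h,
      add_sub_cancel_left, ← mul_assoc, ← Nat.cast_mul, mul_comm, Nat.descFactorial_succ, Nat.sub_sub,
      Nat.cast_comm]

theorem abs_pow_pow (S T : A) (h : T * S = S * T + 1) (n : ℕ) :
    T ^ n * S ^ n = ∑ m ∈ Finset.range (n + 1),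
      ((n.choose m * n.descFactorial (n - m) : ℕ) : A) * (S ^ m * T ^ m) := by
  have hc : Commute (LinearMap.mulRight ℤ T)
      (LinearMap.mulLeft ℤ T - LinearMap.mulRight ℤ T : Module.End ℤ A) :=
    (LinearMap.commute_mulLeft_right (R := ℤ) T T).symm.sub_right (Commute.refl _)
  have h1 := hc.add_pow n
  rw [add_sub_cancel] at h1
  have h2 := congrArg (fun f : Module.End ℤ A => f (S ^ n)) h1
  simp only [LinearMap.pow_mulLeft, LinearMap.mulLeft_apply, LinearMap.sum_apply] at h2
  rw [h2]
  refine Finset.sum_congr rfl fun m hm => ?_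
  have hm' : m ≤ n := by simpa [Nat.lt_succ_iff] using hm
  rw [(Nat.cast_commute (n.choose m) _).symm.eq, Module.End.mul_apply, Module.End.mul_apply,
    abs_ad S T h, LinearMap.pow_mulRight, LinearMap.mulRight_apply, Nat.sub_sub_self hm',
    Nat.cast_mul]
  have : ∀ (c : ℕ) (b : A), ((c : ℕ) : Module.End ℤ A) b = (c : A) * b := by
    intro c b; simp
  rw [this]
  simp only [mul_assoc]

theorem abs_pp (S T : A) (h : T * S = S * T + 1) (p : ℕ) (hp : p.Prime) :
    ∃ e : A, T ^ p * S ^ p = S ^ p * T ^ p + (p : A) * (((p - 1).factorial : A) + p * e) := by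
  have h1 : ∀ m, ∃ e : A, m ∈ Finset.range (p - 1) →
      ((p.choose (m + 1) * p.descFactorial (p - (m + 1)) : ℕ) : A) * (S ^ (m + 1) * T ^ (m + 1))
        = p * (p * e) := by
    intro m
    by_cases hm : m ∈ Finset.range (p - 1)
    · rw [Finset.mem_range] at hm
      obtain ⟨c, hc⟩ := hp.dvd_choose_self (show m + 1 ≠ 0 by omega) (show m + 1 < p by omega)
      obtain ⟨d, hd⟩ : p ∣ p.descFactorial (p - (m + 1)) := by
        obtain ⟨q, rfl⟩ : ∃ q, p = q + 1 := ⟨p - 1, by omega⟩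
        obtain ⟨r, hr⟩ : ∃ r, q + 1 - (m + 1) = r + 1 := ⟨q + 1 - (m + 1) - 1, by omega⟩
        rw [hr, Nat.succ_descFactorial_succ]
        exact Dvd.intro _ rfl
      refine ⟨(c * d : ℕ) * (S ^ (m + 1) * T ^ (m + 1)), fun _ => ?_⟩
      rw [hc, hd]
      generalize S ^ (m + 1) * T ^ (m + 1) = y
      rw [← mul_assoc (p : A) (p : A), ← Nat.cast_mul, ← mul_assoc _ _ y, ← Nat.cast_mul]
      congr 2; ring
    · exact ⟨0, fun h => absurd h hm⟩
  choose e he using h1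
  refine ⟨∑ m ∈ Finset.range (p - 1), e m, ?_⟩
  rw [abs_pow_pow S T h p, Finset.sum_range_succ]
  obtain ⟨q, rfl⟩ : ∃ q, p = q + 1 := ⟨p - 1, by have := hp.pos; omega⟩
  rw [Finset.sum_range_succ']
  rw [Finset.sum_congr rfl (fun m hm => he m (by simpa using hm)), ← Finset.mul_sum, ← Finset.mul_sum]
  simp only [Nat.choose_self, Nat.sub_self, Nat.descFactorial_zero, Nat.choose_zero_right, Nat.sub_zero,
    Nat.descFactorial_self, pow_zero, mul_one, one_mul, Nat.cast_one, Nat.add_sub_cancel,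
    Nat.factorial_succ, Nat.cast_mul, mul_add]
  abel

end abst

section poisson
variable {W k : Type} [CommRing W] [Field k] (p : ℕ) [Fact p.Prime] [CharP k p] (φ : W →+* k)

def Br (u a : Weyl W) (d : Weyl k) : Prop :=
  ∃ b, a * u - u * a = (p : W) • b ∧ map φ b = d

theorem smul_p_map (b : Weyl W) : map φ ((p : W) • b) = 0 := by
  rw [map_smul', map_natCast, CharP.cast_eq_zero, zero_smul]

variable {p φ}

theorem Br.add {u a a' : Weyl W} {d d' : Weyl k} (h : Br p φ u a d) (h' : Br p φ u a' d') :
    Br p φ u (a + a') (d + d') := by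
  obtain ⟨b, hb, rfl⟩ := h
  obtain ⟨b', hb', rfl⟩ := h'
  refine ⟨b + b', ?_, map_add _ _ _⟩
  rw [smul_add, ← hb, ← hb', add_mul, mul_add]; abel

theorem Br.mul {u a a' : Weyl W} {d d' : Weyl k} (h : Br p φ u a d) (h' : Br p φ u a' d') :
    Br p φ u (a * a') (map φ a * d' + d * map φ a') := by
  obtain ⟨b, hb, rfl⟩ := h
  obtain ⟨b', hb', rfl⟩ := h'
  refine ⟨a * b' + b * a', ?_, by simp⟩
  rw [smul_add, ← smul_mul_assoc _ b, ← mul_smul_comm _ a, ← hb, ← hb', mul_sub, sub_mul]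
  simp only [mul_assoc]
  abel

theorem Br.anti {u a : Weyl W} {d : Weyl k} (h : Br p φ u a d) : Br p φ a u (-d) := by
  obtain ⟨b, hb, rfl⟩ := h
  refine ⟨-b, ?_, map_neg _ _⟩
  rw [smul_neg, ← hb]; abel

theorem Br.self (u : Weyl W) : Br p φ u u 0 := ⟨0, by simp, map_zero _⟩

theorem Br.scalar (u : Weyl W) (r : W) : Br p φ u (algebraMap W _ r) 0 :=
  ⟨0, by rw [Algebra.commutes, sub_self, smul_zero], map_zero _⟩

theorem Br.exists (hk : ∀ r, φ r = 0 → ∃ w, r = (p : W) * w) (u a : Weyl W)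
    (hu : ∀ b, map φ u * b = b * map φ u) : ∃ d, Br p φ u a d := by
  obtain ⟨b, hb⟩ := exists_of_map_zero φ (p : W) hk (a * u - u * a) (by
    rw [map_sub, map_mul, map_mul, hu, sub_self])
  exact ⟨_, b, hb, rfl⟩

theorem Br.uniq (hk : ∀ r, φ r = 0 → ∃ w, r = (p : W) * w) (hr : ∀ r : W, (p : W) * r = 0 → r = 0)
    {u a a' : Weyl W} (hu : ∀ b, map φ u * b = b * map φ u) {d d' : Weyl k}
    (h : Br p φ u a d) (h' : Br p φ u a' d') (haa : map φ a = map φ a') : d = d' := by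
  obtain ⟨b, hb, rfl⟩ := h
  obtain ⟨b', hb', rfl⟩ := h'
  obtain ⟨e, he⟩ := exists_of_map_zero φ (p : W) hk (a - a') (by rw [map_sub, haa, sub_self])
  have h1 : (p : W) • (b - b' - (e * u - u * e)) = 0 := by
    rw [smul_sub, smul_sub, smul_sub, ← hb, ← hb', ← smul_mul_assoc, ← mul_smul_comm, ← he, sub_mul,
      mul_sub]
    abel
  have h2 := smul_cancel _ hr _ h1
  have h3 := congrArg (map φ) h2
  rw [map_sub, map_sub, map_sub, map_mul, map_mul, hu, sub_self, sub_zero, map_zero] at h3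
  exact sub_eq_zero.1 h3

theorem Br.chain (hk : ∀ r, φ r = 0 → ∃ w, r = (p : W) * w) (hr : ∀ r : W, (p : W) * r = 0 → r = 0)
    (hsurj : Function.Surjective φ) {u a : Weyl W} (hu : ∀ b, map φ u * b = b * map φ u)
    {d d0 d1 : Weyl k} (h0 : Br p φ u (Wx W ^ p) d0) (h1 : Br p φ u (Wy W ^ p) d1)
    (f : MvPolynomial (Fin 2) k) (hf : map φ a = ce p f) (h : Br p φ u a d) :
    d = ce p (MvPolynomial.pderiv 0 f) * d0 + ce p (MvPolynomial.pderiv 1 f) * d1 := by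
  have key : ∃ a0, map φ a0 = ce p f ∧
      Br p φ u a0 (ce p (MvPolynomial.pderiv 0 f) * d0 + ce p (MvPolynomial.pderiv 1 f) * d1) := by
    clear hf h
    induction f using MvPolynomial.induction_on with
    | C r =>
      obtain ⟨w, rfl⟩ := hsurj r
      refine ⟨algebraMap W _ w, by rw [map_algebraMap, ce_C], ?_⟩
      simpa using Br.scalar u w
    | add f g hf hg =>
      obtain ⟨a0, ha, hb⟩ := hf
      obtain ⟨a1, ha', hb'⟩ := hg
      refine ⟨a0 + a1, by rw [map_add, ha, ha', map_add], ?_⟩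
      have := hb.add hb'
      simp only [map_add, add_mul]
      convert this using 1
      abel
    | mul_X f i hf =>
      obtain ⟨a0, ha, hb⟩ := hf
      have hx := xp_central (k := k) p
      have hy := yp_central (k := k) p
      fin_cases i
      · refine ⟨a0 * Wx W ^ p, ?_, ?_⟩
        · simp only [Fin.zero_eta, ce_mul, ce_X0, map_mul, ha, map_pow, map_x]
        · have := hb.mul h0
          simp only [Fin.zero_eta, MvPolynomial.pderiv_mul, MvPolynomial.pderiv_X_self, mul_one,
            MvPolynomial.pderiv_X_of_ne (show (0 : Fin 2) ≠ 1 by decide), mul_zero, add_zero,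
            map_add, ce_mul, ce_X0, add_mul]
          simp only [ha, map_pow, map_x, add_mul] at this
          convert this using 1
          simp only [mul_assoc]
          rw [hx, hx, add_comm _ (ce p f * d0), add_assoc]
      · refine ⟨a0 * Wy W ^ p, ?_, ?_⟩
        · simp only [Fin.mk_one, ce_mul, ce_X1, map_mul, ha, map_pow, map_y]
        · have := hb.mul h1
          simp only [Fin.mk_one, MvPolynomial.pderiv_mul, MvPolynomial.pderiv_X_self, mul_one,
            MvPolynomial.pderiv_X_of_ne (show (1 : Fin 2) ≠ 0 by decide), mul_zero, add_zero,
            map_add, ce_mul, ce_X1, add_mul]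
          simp only [ha, map_pow, map_y, add_mul] at this
          convert this using 1
          simp only [mul_assoc]
          rw [hy, hy]
          abel
  obtain ⟨a0, ha, hb⟩ := key
  exact Br.uniq hk hr hu h hb (by rw [hf, ha])

theorem Br.base (S T : Weyl W) (h : T * S = S * T + 1) : Br p φ (S ^ p) (T ^ p) (-1) := by
  have hp : p.Prime := Fact.out
  obtain ⟨e, he⟩ := abs_pp S T h p hp
  refine ⟨((p - 1).factorial : Weyl W) + p * e, ?_, ?_⟩
  · rw [he, add_sub_cancel_left, ← map_natCast (algebraMap W (Weyl W)) p, Algebra.smul_def]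
  · rw [map_add, map_mul, map_natCast, map_natCast, W_char0 p, zero_mul, add_zero]
    have h1 := ZMod.wilsons_lemma p
    have h2 : (((p - 1).factorial : ℕ) : k) = -1 := by
      have := congrArg (ZMod.castHom (dvd_refl p) k) h1
      rw [map_natCast, map_neg, map_one] at this
      exact this
    rw [← map_natCast (algebraMap k (Weyl k)), h2, map_neg, map_one]

theorem jac (hk : ∀ r, φ r = 0 → ∃ w, r = (p : W) * w) (hr : ∀ r : W, (p : W) * r = 0 → r = 0)
    (hsurj : Function.Surjective φ) (S T : Weyl W) (h : T * S = S * T + 1)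
    (s t : MvPolynomial (Fin 2) k) (hs : map φ S ^ p = ce p s) (ht : map φ T ^ p = ce p t)
    (hc : ∀ b, map φ S ^ p * b = b * map φ S ^ p) :
    MvPolynomial.pderiv 1 t * MvPolynomial.pderiv 0 s
      - MvPolynomial.pderiv 0 t * MvPolynomial.pderiv 1 s = 1 := by
  have hx : ∀ b, map φ (Wx W ^ p) * b = b * map φ (Wx W ^ p) := by
    intro b; rw [map_pow, map_x, xp_central p]
  have hy : ∀ b, map φ (Wy W ^ p) * b = b * map φ (Wy W ^ p) := by
    intro b; rw [map_pow, map_y, yp_central p]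
  have hS : ∀ b, map φ (S ^ p) * b = b * map φ (S ^ p) := by
    intro b; rw [map_pow, hc]
  have b0 : Br p φ (Wx W ^ p) (Wy W ^ p) (-1) := Br.base _ _ rel
  have b1 : Br p φ (Wy W ^ p) (Wx W ^ p) 1 := by simpa using b0.anti
  have hs' : map φ (S ^ p) = ce p s := by rw [map_pow, hs]
  obtain ⟨d1, hd1⟩ := Br.exists hk (Wx W ^ p) (S ^ p) hx
  have e1 := Br.chain hk hr hsurj hx (Br.self _) b0 s hs' hd1
  obtain ⟨d2, hd2⟩ := Br.exists hk (Wy W ^ p) (S ^ p) hy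
  have e2 := Br.chain hk hr hsurj hy b1 (Br.self _) s hs' hd2
  have e3 := Br.chain hk hr hsurj hS hd1.anti hd2.anti t (by rw [map_pow, ht]) (Br.base S T h)
  apply ce_inj (k := k) p
  rw [map_sub, ce_mul, ce_mul, ce_one]
  have m1 : ∀ a b : Weyl k, a * -b = -(a * b) := fun a b => mul_neg a b
  rw [mul_zero, zero_add, m1, mul_one] at e1
  rw [mul_zero, add_zero, mul_one] at e2
  rw [e1, e2, m1, m1, m1] at e3
  have aux : ∀ {A : Type} [Ring A] (u v : A), -1 = - -u + -v → v - u = 1 := by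
    intro A _ u v h
    have := congrArg Neg.neg h
    rw [neg_neg] at this
    rw [this]; abel
  exact aux _ _ e3

end poisson
end WA
end

section
namespace WA
set_option linter.all false

section comb

theorem nat_max (P : ℕ → Prop) (N : ℕ) (h : ∃ n, P n) (hN : ∀ n, P n → n ≤ N) :
    ∃ m, P m ∧ ∀ n, P n → n ≤ m := by
  classical
  obtain ⟨n, hn⟩ := h
  exact ⟨Nat.findGreatest P N, Nat.findGreatest_spec (hN n hn) hn,
    fun n hn => Nat.le_findGreatest (hN n hn) hn⟩

theorem comb (Pt Ps : ℕ → ℕ → Prop) (N d e p : ℕ)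
    (bt : ∀ i j, Pt i j → i ≤ N ∧ j ≤ N) (bs : ∀ i j, Ps i j → i ≤ N ∧ j ≤ N)
    (h0 : ∀ i, ¬ Pt i 0) (ht : Pt 0 1) (hs : Ps 1 0)
    (hd : ∀ i j, Pt i j → j ≤ d) (he : ∀ i j, Ps i j → i ≤ e) (hp : d * e < p)
    (U : ∀ I J I' J' : ℕ, Pt I J → Ps I' J' → ¬ (p : ℤ) ∣ ((J : ℤ) * I' - I * J') →
      (∀ i j i' j', i + i' = I + I' → j + j' = J + J' → Pt i j → Ps i' j' →
        ¬ (p : ℤ) ∣ ((j : ℤ) * i' - i * j') → i = I ∧ j = J) → I + I' = 1 ∧ J + J' = 1)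
    (i j : ℕ) (hij : Pt i j) : i = 0 ∧ j = 1 := by
  have hd1 : 1 ≤ d := hd _ _ ht
  obtain ⟨I, hI, hIm⟩ := nat_max (fun i => Pt i 1) N ⟨_, ht⟩ (fun n h => (bt _ _ h).1)
  obtain ⟨I', hI', hIm'⟩ := nat_max (fun i => Ps i 0) N ⟨_, hs⟩ (fun n h => (bs _ _ h).1)
  have hI'1 : 1 ≤ I' := hIm' _ hs
  have hI'e : I' ≤ e := he _ _ hI'
  have hI'p : I' < p := by nlinarith
  have row := U I 1 I' 0 hI hI' (by
    intro h
    have : (p : ℤ) ∣ (I' : ℤ) := by simpa using h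
    rw [Int.natCast_dvd_natCast] at this
    exact absurd (Nat.le_of_dvd hI'1 this) (by omega)) (by
    intro i j i' j' h1 h2 h3 h4 _
    have hj : j ≠ 0 := by rintro rfl; exact h0 _ h3
    obtain rfl : j = 1 := by omega
    obtain rfl : j' = 0 := by omega
    have := hIm _ h3
    have := hIm' _ h4
    omega)
  have hI0 : I = 0 := by omega
  have hI'0 : I' = 1 := by omega
  subst hI0 hI'0
  by_contra hne
  have hj0 : j ≠ 0 := by rintro rfl; exact h0 _ hij
  have hj1 : j ≠ 1 := by
    rintro rfl
    have := hIm _ hij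
    exact hne ⟨by omega, rfl⟩
  let F : Set ℚ := {q | (∃ i j, Pt i j ∧ 2 ≤ j ∧ q = (i : ℚ) / ((j : ℚ) - 1)) ∨
    ∃ i j, Ps i j ∧ 1 ≤ j ∧ q = ((i : ℚ) - 1) / j}
  have hF : F.Finite := by
    have f1 : (Set.Iic N ×ˢ Set.Iic N : Set (ℕ × ℕ)).Finite :=
      (Set.finite_Iic N).prod (Set.finite_Iic N)
    refine ((f1.image fun q => (q.1 : ℚ) / ((q.2 : ℚ) - 1)).union
      (f1.image fun q => ((q.1 : ℚ) - 1) / q.2)).subset ?_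
    rintro q (⟨i, j, h1, h2, rfl⟩ | ⟨i, j, h1, h2, rfl⟩)
    · exact Or.inl ⟨(i, j), bt _ _ h1, rfl⟩
    · exact Or.inr ⟨(i, j), bs _ _ h1, rfl⟩
  obtain ⟨μ, hμF, hμ⟩ := Set.exists_max_image F id hF ⟨_, Or.inl ⟨i, j, hij, by omega, rfl⟩⟩
  simp only [id] at hμ
  have hμ0 : 0 ≤ μ := by
    refine le_trans ?_ (hμ _ (Or.inl ⟨i, j, hij, by omega, rfl⟩))
    have : (2 : ℚ) ≤ j := by exact_mod_cast (show 2 ≤ j by omega)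
    apply div_nonneg <;> [positivity; linarith]
  have lt : ∀ i j, Pt i j → (i : ℚ) ≤ μ * (j - 1) := by
    intro i j h
    have hj0 : j ≠ 0 := by rintro rfl; exact h0 _ h
    rcases eq_or_ne j 1 with rfl | hj1
    · have := hIm _ h
      obtain rfl : i = 0 := by omega
      simp
    · have h2 : (2 : ℚ) ≤ j := by exact_mod_cast (show 2 ≤ j by omega)
      have := hμ _ (Or.inl ⟨i, j, h, by omega, rfl⟩)
      rwa [div_le_iff₀ (by linarith)] at this
  have ls : ∀ i j, Ps i j → (i : ℚ) - 1 ≤ μ * j := by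
    intro i j h
    rcases eq_or_ne j 0 with rfl | hj1
    · have : (i : ℚ) ≤ 1 := by exact_mod_cast hIm' _ h
      simpa using hIm' _ h
    · have h2 : (1 : ℚ) ≤ j := by exact_mod_cast (show 1 ≤ j by omega)
      have := hμ _ (Or.inr ⟨i, j, h, by omega, rfl⟩)
      rwa [div_le_iff₀ (by linarith)] at this
  obtain ⟨B, ⟨I, hPB, hBl⟩, hBm⟩ := nat_max (fun j => ∃ i, Pt i j ∧ (i : ℚ) = μ * (j - 1)) N
    ⟨1, 0, ht, by simp⟩ (by rintro n ⟨i, h, _⟩; exact (bt _ _ h).2)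
  obtain ⟨A, ⟨I', hPA, hAl⟩, hAm⟩ := nat_max (fun j => ∃ i, Ps i j ∧ (i : ℚ) - 1 = μ * j) N
    ⟨0, 1, hs, by simp⟩ (by rintro n ⟨i, h, _⟩; exact (bs _ _ h).2)
  have hB1 : 1 ≤ B := hBm 1 ⟨0, ht, by simp⟩
  have hwt : ((B * I' - I * A : ℤ) : ℚ) = B + μ * A := by
    push_cast
    have : (I' : ℚ) = 1 + μ * A := by linarith
    rw [this, hBl]; ring
  have hpos : 0 < (B * I' - I * A : ℤ) := by
    have : (0 : ℚ) < ((B * I' - I * A : ℤ) : ℚ) := by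
      rw [hwt]
      have : (1 : ℚ) ≤ B := by exact_mod_cast hB1
      positivity
    exact_mod_cast this
  have hlt : (B * I' - I * A : ℤ) < p := by
    have h1 : B * I' ≤ d * e := Nat.mul_le_mul (hd _ _ hPB) (he _ _ hPA)
    have h2 : ((B * I' : ℕ) : ℤ) < p := by exact_mod_cast lt_of_le_of_lt h1 hp
    push_cast at h2
    have : (0 : ℤ) ≤ I * A := by positivity
    linarith
  have fin := U I B I' A hPB hPA (by
    intro h
    have := Int.le_of_dvd hpos h
    omega) (by
    intro i j i' j' h1 h2 h3 h4 _
    have e1 := lt _ _ h3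
    have e2 := ls _ _ h4
    have h1' : (i : ℚ) + i' = I + I' := by exact_mod_cast h1
    have h2' : (j : ℚ) + j' = B + A := by exact_mod_cast h2
    have h3' : μ * j + μ * j' = μ * B + μ * A := by rw [← mul_add, h2', mul_add]
    have e3 : (i : ℚ) = μ * (j - 1) := by
      apply le_antisymm e1
      linarith
    have e4 : (i' : ℚ) - 1 = μ * j' := by
      apply le_antisymm e2
      linarith
    have m1 := hBm j ⟨i, h3, e3⟩
    have m2 := hAm j' ⟨i', h4, e4⟩
    obtain rfl : j = B := by omega
    refine ⟨?_, rfl⟩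
    have : (i : ℚ) = I := by rw [e3, hBl]
    exact_mod_cast this)
  rcases hμF with ⟨i, j, h1, h2, h3⟩ | ⟨i, j, h1, h2, h3⟩
  · have h4 : (2 : ℚ) ≤ j := by exact_mod_cast h2
    have := hBm j ⟨i, h1, by rw [h3, div_mul_cancel₀]; linarith⟩
    omega
  · have h4 : (1 : ℚ) ≤ j := by exact_mod_cast h2
    have := hAm j ⟨i, h1, by rw [h3, div_mul_cancel₀]; linarith⟩
    omega

end comb

section poly
open MvPolynomial Finset.HasAntidiagonal
variable {k : Type} [Field k] (p : ℕ) [Fact p.Prime] [CharP k p]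

theorem coeff_euler (i : Fin 2) (f : MvPolynomial (Fin 2) k) (m : Fin 2 →₀ ℕ) :
    coeff m (MvPolynomial.X i * pderiv i f) = m i * coeff m f := by
  induction f using MvPolynomial.induction_on' with
  | add f g hf hg => rw [map_add, mul_add, coeff_add, hf, hg, coeff_add, mul_add]
  | monomial n r =>
    classical
    rw [X_mul_pderiv_monomial, coeff_smul, coeff_monomial]
    split_ifs with h
    · subst h; simp
    · simp

theorem jac_coeff (s t : MvPolynomial (Fin 2) k)
    (h : pderiv 1 t * pderiv 0 s - pderiv 0 t * pderiv 1 s = 1) (n : Fin 2 →₀ ℕ) :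
    ∑ x ∈ antidiagonal n, (((x.1 1 : ℤ) * x.2 0 - x.1 0 * x.2 1 : ℤ) : k)
      * (coeff x.1 t * coeff x.2 s) = if ex 1 1 = n then 1 else 0 := by
  classical
  have h1 : (MvPolynomial.X 1 * pderiv 1 t) * (MvPolynomial.X 0 * pderiv 0 s)
      - (MvPolynomial.X 0 * pderiv 0 t) * (MvPolynomial.X 1 * pderiv 1 s) = monomial (ex 1 1) 1 := by
    have : (monomial (ex 1 1) 1 : MvPolynomial (Fin 2) k) = MvPolynomial.X 0 * MvPolynomial.X 1 := by
      rw [MvPolynomial.X, MvPolynomial.X, monomial_mul, one_mul]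
      congr 2
      apply ex_ext <;> simp
    rw [this]
    linear_combination (MvPolynomial.X 0 * MvPolynomial.X 1) * h
  have h2 := congrArg (coeff n) h1
  rw [coeff_sub, coeff_mul, coeff_mul, coeff_monomial, ← Finset.sum_sub_distrib] at h2
  rw [← h2]
  refine Finset.sum_congr rfl fun x _ => ?_
  simp only [coeff_euler]
  push_cast
  ring

theorem poly_lemma (s t : MvPolynomial (Fin 2) k)
    (h : pderiv 1 t * pderiv 0 s - pderiv 0 t * pderiv 1 s = 1)
    (h0 : ∀ i, coeff (ex i 0) t = 0) (d e : ℕ) (hd : ∀ i j, d < j → coeff (ex i j) t = 0)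
    (he : ∀ i j, e < i → coeff (ex i j) s = 0) (hde : d * e < p) (i j : ℕ)
    (hij : coeff (ex i j) t ≠ 0) : i = 0 ∧ j = 1 := by
  classical
  have exm : ∀ m : Fin 2 →₀ ℕ, m = ex (m 0) (m 1) := fun m => ex_ext _ _ rfl rfl
  have J := jac_coeff s t h
  have hcast : ∀ z : ℤ, (z : k) = 0 ↔ (p : ℤ) ∣ z := fun z => CharP.intCast_eq_zero_iff k p z
  have bd : ∀ f : MvPolynomial (Fin 2) k, ∃ N, ∀ i j, coeff (ex i j) f ≠ 0 → i ≤ N ∧ j ≤ N := by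
    intro f
    refine ⟨f.totalDegree, fun i j hc => ?_⟩
    have := le_totalDegree (mem_support_iff.2 hc)
    rw [Finsupp.sum_fintype _ _ (by simp), Fin.sum_univ_two, ex0, ex1] at this
    omega
  obtain ⟨N1, hN1⟩ := bd t
  obtain ⟨N2, hN2⟩ := bd s
  have start : coeff (ex 0 1) t ≠ 0 ∧ coeff (ex 1 0) s ≠ 0 := by
    have h1 := J (ex 1 1)
    rw [if_pos rfl] at h1
    obtain ⟨x, hx, hne⟩ := Finset.exists_ne_zero_of_sum_ne_zero (by rw [h1]; exact one_ne_zero)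
    rw [mem_antidiagonal] at hx
    have e0 : x.1 0 + x.2 0 = 1 := by
      have := DFunLike.congr_fun hx 0; simpa using this
    have e1 : x.1 1 + x.2 1 = 1 := by
      have := DFunLike.congr_fun hx 1; simpa using this
    have n1 : coeff x.1 t ≠ 0 := by intro h; simp [h] at hne
    have n2 : coeff x.2 s ≠ 0 := by intro h; simp [h] at hne
    have hj : x.1 1 ≠ 0 := by
      intro h
      rw [exm x.1, h, h0] at n1
      exact n1 rfl
    have hj1 : x.1 1 = 1 := by omega
    have hj2 : x.2 1 = 0 := by omega
    have hi : x.2 0 ≠ 0 := by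
      intro h
      simp [h, hj2] at hne
    have hi1 : x.2 0 = 1 := by omega
    have hi2 : x.1 0 = 0 := by omega
    rw [exm x.1, hi2, hj1] at n1
    rw [exm x.2, hi1, hj2] at n2
    exact ⟨n1, n2⟩
  refine comb (fun i j => coeff (ex i j) t ≠ 0) (fun i j => coeff (ex i j) s ≠ 0) (N1 + N2) d e p
    (fun i j h => ?_) (fun i j h => ?_) (fun i h => h (h0 i)) start.1 start.2
    (fun i j h => ?_) (fun i j h => ?_) hde ?_ i j hij
  · have := hN1 i j h; omega
  · have := hN2 i j h; omega
  · by_contra hlt; exact h (hd i j (by omega))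
  · by_contra hlt; exact h (he i j (by omega))
  · intro I J' I' J'' h1 h2 hw hu
    have h3 := J (ex I J' + ex I' J'')
    rw [Finset.sum_eq_single (ex I J', ex I' J'')] at h3
    · have h4 : ex 1 1 = ex I J' + ex I' J'' := by
        by_contra hne
        rw [if_neg hne] at h3
        simp only [ex0, ex1, mul_eq_zero, hcast] at h3
        tauto
      have a0 := DFunLike.congr_fun h4 0
      have a1 := DFunLike.congr_fun h4 1
      simp at a0 a1
      exact ⟨a0.symm, a1.symm⟩
    · rintro ⟨a, b⟩ hab hne
      rw [mem_antidiagonal] at hab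
      have a0 := DFunLike.congr_fun hab 0
      have a1 := DFunLike.congr_fun hab 1
      simp at a0 a1
      by_contra hnz
      have n1 : coeff a t ≠ 0 := by intro h; simp [h] at hnz
      have n2 : coeff b s ≠ 0 := by intro h; simp [h] at hnz
      have n3 : ¬ (p : ℤ) ∣ ((a 1 : ℤ) * b 0 - a 0 * b 1) := by
        rw [← hcast]; intro h; apply hnz; simp only [h, zero_mul]
      rw [exm a] at n1
      rw [exm b] at n2
      have := hu _ _ _ _ a0 a1 n1 n2 n3
      apply hne
      have e1 : a = ex I J' := ex_ext _ _ this.1 this.2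
      refine Prod.ext e1 (ex_ext _ _ ?_ ?_)
      · simp; omega
      · simp; omega
    · intro h; exfalso; apply h; rw [mem_antidiagonal]

end poly
end WA
end

section
namespace WA
set_option linter.all false

section lemA
variable {W k : Type} [CommRing W] [Field k] {p : ℕ} [Fact p.Prime] [CharP k p] {φ : W →+* k}

theorem cf_pow_top (a : Weyl k) (ha : a ≠ 0) (n : ℕ) : ∃ j, cf (a ^ n) (n * dx a) j ≠ 0 := by
  by_contra! hc
  have h1 : σ a ≠ 0 := fun h => ha (σ_inj (by rw [h, map_zero]))
  have h2 := (σ_pow_coeff_top a (dx a) n fun k => Polynomial.coeff_eq_zero_of_natDegree_lt).2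
  have h3 : (σ (a ^ n)).coeff (n * dx a) = 0 := by
    ext j; rw [Polynomial.coeff_zero]; exact hc j
  rw [h3] at h2
  have h4 : (σ a).coeff (dx a) ≠ 0 := by
    simpa [dx] using h1
  exact h4 (eq_zero_of_pow_eq_zero h2.symm)

theorem neg_pow_odd (a : Weyl k) (hp : Odd p) : (-a) ^ p = - a ^ p := by
  have aux : ∀ {A : Type} [Ring A] (u : A), (-u) ^ p = - u ^ p := by
    intro A _ u
    exact hp.neg_pow u
  exact aux a

theorem lemmaA (hk : ∀ r, φ r = 0 → ∃ w, r = (p : W) * w) (hr : ∀ r : W, (p : W) * r = 0 → r = 0)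
    (hsurj : Function.Surjective φ) (hp2 : p ≠ 2) (S T : Weyl W) (h : T * S = S * T + 1)
    (hT : st T = -T) (hdeg : dy (map φ T) * dx (map φ S) < p) (i j : ℕ)
    (hij : cf (map φ T) i j ≠ 0) : i = 0 ∧ j ≤ 1 := by
  have hp : p.Prime := Fact.out
  have hodd : Odd p := hp.odd_of_ne_two hp2
  have h' : map φ T * map φ S = map φ S * map φ T + 1 := by
    rw [← map_mul, h, map_add, map_mul, map_one]
  have hTc := Tp_central p _ _ h'
  have hSc := Sp_central p _ _ h'
  obtain ⟨t, ht⟩ := central_ce p _ hTc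
  obtain ⟨s, hs⟩ := central_ce p _ hSc
  have J := jac hk hr hsurj S T h s t hs.symm ht.symm hSc
  have hT' : st (map φ T) = - map φ T := by rw [← map_st, hT, map_neg]
  have hT0 : map φ T ≠ 0 := by intro h0; rw [h0, cf_zero] at hij; exact hij rfl
  have h2 : (2 : k) ≠ 0 := by
    have : ((2 : ℕ) : k) ≠ 0 := by
      rw [Ne, CharP.cast_eq_zero_iff k p]
      intro hd
      exact hp2 ((Nat.prime_dvd_prime_iff_eq hp Nat.prime_two).1 hd)
    simpa using this
  have h0 : ∀ i, MvPolynomial.coeff (ex i 0) t = 0 := by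
    intro i
    have e1 := st_ce p t i 0
    rw [ht, st_pow, hT', neg_pow_odd _ hodd, cf_neg, ← ht, cf_ce, mul_zero, pow_zero, one_mul] at e1
    have : (2 : k) * MvPolynomial.coeff (ex i 0) t = 0 := by linear_combination -e1
    exact (mul_eq_zero.1 this).resolve_left h2
  have P := poly_lemma p s t J h0 (dy (map φ T)) (dx (map φ S)) (by
    intro i j hj
    rw [← cf_ce p, ht]
    exact cf_pow_dy _ _ _ _ (Nat.mul_lt_mul_of_pos_left hj hp.pos)) (by
    intro i j hi
    rw [← cf_ce p, hs]
    exact cf_pow_dx _ _ _ _ (Nat.mul_lt_mul_of_pos_left hi hp.pos)) hdeg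
  have ht1 : t = MvPolynomial.monomial (ex 0 1) (MvPolynomial.coeff (ex 0 1) t) := by
    classical
    ext m
    rw [MvPolynomial.coeff_monomial]
    split_ifs with hm
    · rw [hm]
    · by_contra hne
      have hm' : m = ex (m 0) (m 1) := ex_ext _ _ rfl rfl
      rw [hm'] at hne
      have := P _ _ hne
      exact hm (ex_ext _ _ this.1.symm this.2.symm)
  rw [ht1, ce_mono] at ht
  simp only [ex0, ex1, mul_zero, mul_one] at ht
  constructor
  · obtain ⟨l, hl⟩ := cf_pow_top (map φ T) hT0 p
    rw [← ht, cf_smul, cf_mo] at hl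
    have : dx (map φ T) = 0 := by
      by_contra hne
      rw [if_neg] at hl
      · simp at hl
      · rintro ⟨h, -⟩
        rcases mul_eq_zero.1 h.symm with h | h
        · exact hp.ne_zero h
        · exact hne h
    by_contra hi
    exact hij (cf_dx _ _ _ (by omega))
  · have hal : al (map φ T) ≠ 0 := by
      intro h; apply hT0; rw [← al_al (map φ T), h, map_zero]
    obtain ⟨l, hl⟩ := cf_pow_top (al (map φ T)) hal p
    rw [← al_pow, ← ht, map_smul, al_mo, cf_smul, cf_mo] at hl
    have : dy (map φ T) = 1 := by
      by_contra hne
      rw [if_neg] at hl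
      · simp at hl
      · rintro ⟨h, -⟩
        apply hne
        have : p * 1 = p * dx (al (map φ T)) := by rw [mul_one]; exact h
        exact (mul_left_cancel₀ hp.ne_zero this).symm
    by_contra hi
    exact hij (cf_dy _ _ _ (by omega))

end lemA
end WA
end

section
namespace WA
open Polynomial
set_option linter.all false

theorem prime_root (g : ℤ[X]) (hg : 0 < g.natDegree) (N : ℕ) :
    ∃ p : ℕ, p.Prime ∧ N < p ∧ ∃ a : ℤ, (p : ℤ) ∣ g.eval a := by
  by_cases h0 : g.coeff 0 = 0
  · obtain ⟨p, hp, hp'⟩ := Nat.exists_infinite_primes (N + 1)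
    refine ⟨p, hp', by omega, 0, ?_⟩
    rw [← Polynomial.coeff_zero_eq_eval_zero, h0]
    exact dvd_zero _
  · set c := g.coeff 0 with hc
    have hev : ∀ a : ℤ, g.eval a = a * g.divX.eval a + c := by
      intro a
      conv_lhs => rw [← Polynomial.divX_mul_X_add g]
      simp [mul_comm, hc]
    have hinj : Function.Injective fun y : ℤ => c * (N.factorial : ℤ) * y := by
      intro y z h
      have : c * (N.factorial : ℤ) ≠ 0 := mul_ne_zero h0 (by exact_mod_cast N.factorial_ne_zero)
      exact mul_left_cancel₀ this h
    have hne : ∀ d : ℤ, g - C d ≠ 0 := by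
      intro d h
      have : g = C d := sub_eq_zero.1 h
      rw [this] at hg; simp at hg
    have hfin : ∀ d : ℤ, {a : ℤ | g.eval a = d}.Finite := by
      intro d
      refine ((g - C d).roots.toFinset.finite_toSet).subset ?_
      intro a ha
      simp only [Set.mem_setOf_eq] at ha
      rw [Finset.mem_coe, Multiset.mem_toFinset, Polynomial.mem_roots (hne d), Polynomial.IsRoot.def, eval_sub, eval_C, ha, sub_self]
    have hfin2 := ((hfin c).union (hfin (-c))).preimage (hinj.injOn)
    obtain ⟨y, hy⟩ := hfin2.infinite_compl.nonempty
    simp only [Set.mem_compl_iff, Set.mem_preimage, Set.mem_union, Set.mem_setOf_eq, not_or] at hy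
    set a := c * (N.factorial : ℤ) * y with ha
    set m := 1 + (N.factorial : ℤ) * y * g.divX.eval a with hm
    have hgm : g.eval a = c * m := by rw [hev, hm]; nth_rewrite 1 [ha]; ring
    have hm1 : m.natAbs ≠ 1 := by
      intro h
      rcases Int.natAbs_eq_iff.1 h with h | h
      · exact hy.1 (by rw [hgm, h]; simp)
      · exact hy.2 (by rw [hgm, h]; simp)
    obtain ⟨p, hp, hpm⟩ := Nat.exists_prime_and_dvd hm1
    refine ⟨p, hp, ?_, a, ?_⟩
    · by_contra hle
      have h1 : p ∣ N.factorial := hp.dvd_factorial.2 (not_lt.1 hle)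
      have h2 : (p : ℤ) ∣ (N.factorial : ℤ) := by exact_mod_cast h1
      have h3 : (p : ℤ) ∣ m := Int.natCast_dvd.2 hpm
      have h4 : (p : ℤ) ∣ 1 := by
        have := dvd_sub h3 ((h2.mul_right y).mul_right (g.divX.eval a))
        simpa [hm] using this
      have := Int.natCast_dvd.1 h4
      simp at this
      exact hp.one_lt.ne' this
    · rw [hgm]; exact (Int.natCast_dvd.2 hpm).mul_left c

theorem clear (f : ℚ[X]) : ∃ (b : ℤ) (g : ℤ[X]), b ≠ 0 ∧ g.map (Int.castRingHom ℚ) = C (b : ℚ) * f := by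
  obtain ⟨b, hb, h⟩ := IsLocalization.integerNormalization_spec (nonZeroDivisors ℤ) f
  refine ⟨b, IsLocalization.integerNormalization (nonZeroDivisors ℤ) f, nonZeroDivisors.ne_zero hb, ?_⟩
  rw [show Int.castRingHom ℚ = algebraMap ℤ ℚ from rfl, h]
  ext n
  simp

theorem norm_int_one {p : ℕ} [Fact p.Prime] (b : ℤ) (hb : b ≠ 0) (hp : b.natAbs < p) :
    ‖(b : ℚ_[p])‖ = 1 := by
  refine le_antisymm (Padic.norm_int_le_one b) (not_lt.1 fun h => ?_)
  rw [Padic.norm_intCast_lt_one_iff] at h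
  have := Nat.le_of_dvd (Int.natAbs_pos.2 hb) (Int.natCast_dvd.1 h)
  omega

theorem nf_padic (F : Type) [Field F] [Algebra ℚ F] [FiniteDimensional ℚ F] (H : Finset F) (N : ℕ) :
    ∃ (p : ℕ) (_ : Fact p.Prime), N < p ∧ ∃ Φ : F →+* ℚ_[p], ∀ x ∈ H, ‖Φ x‖ ≤ 1 := by
  haveI : CharZero F := algebraRat.charZero F
  let pb := Field.powerBasisOfFiniteOfSeparable ℚ F
  set f := minpoly ℚ pb.gen with hf
  obtain ⟨b, g, hb, hg⟩ := clear f
  have hbQ : (b : ℚ) ≠ 0 := by exact_mod_cast hb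
  have hsep : f.Separable := Algebra.IsSeparable.isSeparable ℚ pb.gen
  have hirr : Irreducible f := minpoly.irreducible (Algebra.IsIntegral.isIntegral _)
  obtain ⟨A, B, hAB⟩ := hsep
  obtain ⟨a1, A', ha1, hA'⟩ := clear A
  obtain ⟨b1, B', hb1, hB'⟩ := clear B
  have bez : C b1 * A' * g + C a1 * B' * derivative g = C (a1 * b1 * b) := by
    apply Polynomial.map_injective (Int.castRingHom ℚ) Int.cast_injective
    simp only [Polynomial.map_add, Polynomial.map_mul, Polynomial.map_C, ← Polynomial.derivative_map,
      hg, hA', hB', Polynomial.derivative_C_mul]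
    simp only [eq_intCast, Int.cast_mul, C_mul]
    linear_combination (C (b1 : ℚ) * C (a1 : ℚ) * C (b : ℚ)) * hAB
  have hgd : 0 < g.natDegree := by
    have : (g.map (Int.castRingHom ℚ)).natDegree = f.natDegree := by
      rw [hg, Polynomial.natDegree_C_mul hbQ]
    rw [Polynomial.natDegree_map_eq_of_injective Int.cast_injective] at this
    rw [this]; exact hirr.natDegree_pos
  have hrep : ∀ x : F, ∃ (d : ℤ) (r : ℤ[X]), d ≠ 0 ∧ (d : F) * x = aeval pb.gen r := by
    intro x
    obtain ⟨q, -, hq⟩ := pb.exists_eq_aeval x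
    obtain ⟨d, r, hd, hr⟩ := clear q
    refine ⟨d, r, hd, ?_⟩
    have h2 : aeval pb.gen (r.map (Int.castRingHom ℚ)) = aeval pb.gen r := by
      rw [show Int.castRingHom ℚ = algebraMap ℤ ℚ from rfl, Polynomial.aeval_map_algebraMap]
    rw [← h2, hr, map_mul, ← hq, aeval_C]; simp
  choose d r hd hr using hrep
  obtain ⟨p, hp, hpN, a, ha⟩ := prime_root g hgd (N + (a1 * b1 * b).natAbs + ∑ x ∈ H, (d x).natAbs)
  haveI : Fact p.Prime := ⟨hp⟩
  refine ⟨p, ⟨hp⟩, by omega, ?_⟩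
  have hD : ‖((a1 * b1 * b : ℤ) : ℚ_[p])‖ = 1 := norm_int_one _ (by simp [ha1, hb1, hb]) (by omega)
  have hga : (aeval (a : ℤ_[p]) g) = ((g.eval a : ℤ) : ℤ_[p]) := by
    have := Polynomial.aeval_algebraMap_apply ℤ_[p] a g
    simpa using this
  have hga' : (aeval (a : ℤ_[p]) (derivative g)) = (((derivative g).eval a : ℤ) : ℤ_[p]) := by
    have := Polynomial.aeval_algebraMap_apply ℤ_[p] a (derivative g)
    simpa using this
  have n1 : ‖aeval (a : ℤ_[p]) g‖ < 1 := by
    rw [hga, PadicInt.norm_int_lt_one_iff_dvd]; exact ha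
  have n2 : ‖aeval (a : ℤ_[p]) (derivative g)‖ = 1 := by
    rw [hga']
    refine le_antisymm (PadicInt.norm_le_one _) (not_lt.1 fun h => ?_)
    rw [PadicInt.norm_int_lt_one_iff_dvd] at h
    have e := congrArg (fun q => Polynomial.eval a q) bez
    simp only [eval_add, eval_mul, eval_C] at e
    have : (p : ℤ) ∣ a1 * b1 * b := by
      rw [← e]; exact dvd_add (ha.mul_left _) (h.mul_left _)
    rw [← Padic.norm_intCast_lt_one_iff, hD] at this
    exact lt_irrefl _ this
  obtain ⟨z, hz, -⟩ := hensels_lemma (F := g) (a := (a : ℤ_[p])) (by rw [n2]; simpa using n1)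
  have hz' : aeval (z : ℚ_[p]) f = 0 := by
    have h1 : aeval (z : ℚ_[p]) g = 0 := by
      have := congrArg (algebraMap ℤ_[p] ℚ_[p]) hz
      rw [map_zero, ← Polynomial.aeval_algebraMap_apply] at this
      exact this
    have h2 : aeval (z : ℚ_[p]) (g.map (Int.castRingHom ℚ)) = aeval (z : ℚ_[p]) g := by
      rw [show Int.castRingHom ℚ = algebraMap ℤ ℚ from rfl, Polynomial.aeval_map_algebraMap]
    rw [h1, hg, map_mul, aeval_C] at h2
    exact (mul_eq_zero.1 h2).resolve_left (by simpa using hb)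
  let Φ : F →ₐ[ℚ] ℚ_[p] := pb.lift (z : ℚ_[p]) hz'
  refine ⟨Φ.toRingHom, fun x hx => ?_⟩
  have hΦ : Φ pb.gen = z := pb.lift_gen _ _
  have e := congrArg Φ.toRingHom (hr x)
  have e2 : Φ.toRingHom (aeval pb.gen (r x)) = ((aeval z (r x) : ℤ_[p]) : ℚ_[p]) := by
    rw [Polynomial.aeval_def, Polynomial.hom_eval₂]
    have : Φ.toRingHom pb.gen = z := hΦ
    rw [this]
    have := Polynomial.aeval_algebraMap_apply ℚ_[p] z (r x)
    refine Eq.trans ?_ this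
    rw [Polynomial.aeval_def]
    congr 1
    exact RingHom.ext_int _ _
  rw [e2, map_mul, map_intCast] at e
  have e3 := congrArg norm e
  have hle : (d x).natAbs ≤ ∑ x ∈ H, (d x).natAbs :=
    Finset.single_le_sum (f := fun x => (d x).natAbs) (fun _ _ => Nat.zero_le _) hx
  rw [norm_mul, norm_int_one _ (hd x) (by omega), one_mul] at e3
  rw [e3]
  exact PadicInt.norm_le_one _

theorem ft_padic (R : Type) [CommRing R] [Nontrivial R] [Algebra ℚ R] [Algebra.FiniteType ℚ R]
    (H : Finset R) (N : ℕ) :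
    ∃ (p : ℕ) (_ : Fact p.Prime), N < p ∧ ∃ Φ : R →+* ℚ_[p], ∀ x ∈ H, ‖Φ x‖ ≤ 1 := by
  classical
  obtain ⟨m, hm⟩ := Ideal.exists_maximal R
  letI : Field (R ⧸ m) := Ideal.Quotient.field m
  letI : Algebra ℚ (R ⧸ m) := Ideal.Quotient.algebra ℚ
  haveI : Algebra.FiniteType ℚ (R ⧸ m) := Algebra.FiniteType.of_surjective (Ideal.Quotient.mkₐ ℚ m) (Ideal.Quotient.mkₐ_surjective ℚ m)
  haveI : Module.Finite ℚ (R ⧸ m) := finite_of_finite_type_of_isJacobsonRing ℚ (R ⧸ m)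
  obtain ⟨p, hp, hN, Φ, hΦ⟩ := nf_padic (R ⧸ m) (H.image (Ideal.Quotient.mk m)) N
  exact ⟨p, hp, hN, Φ.comp (Ideal.Quotient.mk m), fun x hx => hΦ _ (Finset.mem_image_of_mem _ hx)⟩

theorem lemmaB (K : Type) [Field K] [CharZero K] (G : Finset K) (c0 : K) (hc0 : c0 ≠ 0) (hc : c0 ∈ G)
    (N : ℕ) : ∃ (p : ℕ) (_ : Fact p.Prime) (O : Type) (_ : CommRing O) (i : O →+* K) (ψ : O →+* ℤ_[p]),
      N < p ∧ Function.Injective i ∧ (∀ c ∈ G, ∃ o, i o = c) ∧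
      ∀ o, i o = c0 → PadicInt.toZMod (ψ o) ≠ 0 := by
  classical
  let G' : Finset K := insert c0⁻¹ G
  let R : Subalgebra ℚ K := Algebra.adjoin ℚ (G' : Set K)
  have hfg : R.FG := ⟨G', rfl⟩
  haveI : Algebra.FiniteType ℚ R := R.fg_iff_finiteType.1 hfg
  have hmem : ∀ c ∈ G', c ∈ R := fun c h => Algebra.subset_adjoin h
  obtain ⟨p, hp, hN, Ψ, hΦ⟩ := ft_padic R (G'.attach.image fun c : {c // c ∈ G'} => (⟨c.1, hmem c.1 c.2⟩ : R)) N
  have hΨ : ∀ c (h : c ∈ G'), ‖Ψ ⟨c, hmem c h⟩‖ ≤ 1 := fun c h =>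
    hΦ _ (Finset.mem_image.2 ⟨⟨c, h⟩, Finset.mem_attach _ _, rfl⟩)
  let O : Subring R := (PadicInt.subring p).comap Ψ
  let ψ : O →+* ℤ_[p] :=
    { toFun := fun o => ⟨Ψ o, o.2⟩
      map_one' := Subtype.ext (map_one Ψ)
      map_zero' := Subtype.ext (map_zero Ψ)
      map_add' := fun a b => Subtype.ext (map_add Ψ a.1 b.1)
      map_mul' := fun a b => Subtype.ext (map_mul Ψ a.1 b.1) }
  let i : O →+* K := R.val.toRingHom.comp O.subtype
  have hi : Function.Injective i := fun a b h => Subtype.ext (Subtype.ext h)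
  refine ⟨p, hp, O, inferInstance, i, ψ, hN, hi, fun c h =>
    ⟨⟨⟨c, hmem c (Finset.mem_insert_of_mem h)⟩, hΨ c (Finset.mem_insert_of_mem h)⟩, rfl⟩, ?_⟩
  intro o ho h0
  let o' : O := ⟨⟨c0⁻¹, hmem _ (Finset.mem_insert_self _ _)⟩, hΨ _ (Finset.mem_insert_self _ _)⟩
  have : o * o' = 1 := hi (by rw [map_mul, map_one, ho]; exact mul_inv_cancel₀ hc0)
  have h := congrArg (fun u => PadicInt.toZMod (ψ u)) this
  simp only [map_mul, map_one, h0, zero_mul] at h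
  exact zero_ne_one h

end WA
end

section
namespace WA
open Polynomial
set_option linter.all false

theorem dx_le {R : Type} [CommRing R] (a : Weyl R) (n : ℕ) (h : ∀ i j, n < i → cf a i j = 0) : dx a ≤ n := by
  rw [dx, Polynomial.natDegree_le_iff_coeff_eq_zero]
  intro i hi
  ext j
  rw [Polynomial.coeff_zero]
  exact h i j hi

theorem dy_le {R : Type} [CommRing R] (a : Weyl R) (n : ℕ) (h : ∀ i j, n < j → cf a i j = 0) : dy a ≤ n :=
  dx_le _ _ fun i j hi => by rw [cf_al]; exact h j i hi

theorem lemmaC {K : Type} [Field K] [CharZero K] (S T : Weyl K) (h : T * S = S * T + 1)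
    (hT : st T = -T) (i0 j0 : ℕ) (hij : cf T i0 j0 ≠ 0) : i0 = 0 ∧ j0 ≤ 1 := by
  classical
  set M := dx S + dy S + dx T + dy T + i0 + j0 + 1 with hM
  let G : Finset K := (Finset.range M ×ˢ Finset.range M).image (fun q => cf S q.1 q.2) ∪
    (Finset.range M ×ˢ Finset.range M).image (fun q => cf T q.1 q.2)
  have hc : cf T i0 j0 ∈ G := Finset.mem_union_right _ (Finset.mem_image.2
    ⟨(i0, j0), by simp [hM]; omega, rfl⟩)
  obtain ⟨p, hp, O, _, i, ψ, hN, hi, hG, hc0⟩ := lemmaB K G (cf T i0 j0) hij hc (2 + dy T * dx S)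
  have hS' : ∀ a b, ∃ r, i r = cf S a b := by
    intro a b
    by_cases hab : a < M ∧ b < M
    · exact hG _ (Finset.mem_union_left _ (Finset.mem_image.2 ⟨(a, b), by simpa using hab, rfl⟩))
    · refine ⟨0, ?_⟩
      rw [map_zero]
      by_cases ha : a < M
      · exact (cf_dy _ _ _ (by omega)).symm
      · exact (cf_dx _ _ _ (by omega)).symm
  have hT' : ∀ a b, ∃ r, i r = cf T a b := by
    intro a b
    by_cases hab : a < M ∧ b < M
    · exact hG _ (Finset.mem_union_right _ (Finset.mem_image.2 ⟨(a, b), by simpa using hab, rfl⟩))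
    · refine ⟨0, ?_⟩
      rw [map_zero]
      by_cases ha : a < M
      · exact (cf_dy _ _ _ (by omega)).symm
      · exact (cf_dx _ _ _ (by omega)).symm
  obtain ⟨S1, hS1⟩ := mem_range_map i S hS'
  obtain ⟨T1, hT1⟩ := mem_range_map i T hT'
  have r1 : T1 * S1 = S1 * T1 + 1 := map_injective i hi (by
    rw [map_add, map_mul, map_mul, map_one, hS1, hT1, h])
  have r2 : st T1 = -T1 := map_injective i hi (by rw [map_st, map_neg, hT1, hT])
  have r1' : map ψ T1 * map ψ S1 = map ψ S1 * map ψ T1 + 1 := by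
    rw [← map_mul, r1, map_add, map_mul, map_one]
  have r2' : st (map ψ T1) = - map ψ T1 := by rw [← map_st, r2, map_neg]
  have cS : ∀ a b, cf S a b = 0 → cf (map PadicInt.toZMod (map ψ S1)) a b = 0 := by
    intro a b h0
    rw [← hS1, cf_map] at h0
    rw [cf_map, cf_map, hi (h0.trans (map_zero i).symm), map_zero, map_zero]
  have cT : ∀ a b, cf T a b = 0 → cf (map PadicInt.toZMod (map ψ T1)) a b = 0 := by
    intro a b h0
    rw [← hT1, cf_map] at h0
    rw [cf_map, cf_map, hi (h0.trans (map_zero i).symm), map_zero, map_zero]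
  refine lemmaA (p := p) (φ := (PadicInt.toZMod : ℤ_[p] →+* ZMod p)) ?_ ?_ ?_ (by omega)
    (map ψ S1) (map ψ T1) r1' r2' ?_ i0 j0 ?_
  · intro r hr
    have : r ∈ RingHom.ker (PadicInt.toZMod : ℤ_[p] →+* ZMod p) := hr
    rw [PadicInt.ker_toZMod, PadicInt.maximalIdeal_eq_span_p, Ideal.mem_span_singleton] at this
    exact this
  · intro r hr
    exact (mul_eq_zero.1 hr).resolve_left (by exact_mod_cast hp.out.ne_zero)
  · exact ZMod.ringHom_surjective _
  · have d1 := dy_le (map PadicInt.toZMod (map ψ T1)) (dy T) fun a b hb => cT a b (cf_dy _ _ _ hb)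
    have d2 := dx_le (map PadicInt.toZMod (map ψ S1)) (dx S) fun a b hb => cS a b (cf_dx _ _ _ hb)
    have := Nat.mul_le_mul d1 d2
    omega
  · rw [cf_map, cf_map]
    exact hc0 _ (by rw [← cf_map, hT1])

theorem main {K : Type} [Field K] [CharZero K] (S T : Weyl K) (h : T * S = S * T + 1)
    (hT : st T = -T) : ∃ c : K, T = c • Wy K := by
  have e : T = cf T 0 0 • (1 : Weyl K) + cf T 0 1 • Wy K := by
    have m1 : (1 : Weyl K) = mo 0 0 := by simp [mo]
    have m2 : Wy K = mo 0 1 := by simp [mo]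
    apply cf_ext
    intro i j
    rw [m1, m2, cf_add, cf_smul, cf_smul, cf_mo, cf_mo]
    by_cases hij : cf T i j = 0
    · rw [hij]
      split_ifs with h1 h2 h2
      · omega
      · obtain ⟨rfl, rfl⟩ := h1; rw [hij]; simp
      · obtain ⟨rfl, rfl⟩ := h2; rw [hij]; simp
      · simp
    · obtain ⟨h1, h2⟩ := lemmaC S T h hT i j hij
      subst h1
      interval_cases j <;> simp
  have h0 : cf T 0 0 = 0 := by
    have m1 : (1 : Weyl K) = mo 0 0 := by simp [mo]
    have m2 : Wy K = mo 0 1 := by simp [mo]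
    have e2 := congrArg (fun a => cf (st a) 0 0) e
    simp only [map_add, map_smul, st_one, st_y, hT, cf_neg, cf_add, cf_smul] at e2
    rw [m1, m2, cf_mo, cf_mo] at e2
    simp at e2
    have : (2 : K) * cf T 0 0 = 0 := by linear_combination -e2
    exact (mul_eq_zero.1 this).resolve_left two_ne_zero
  refine ⟨cf T 0 1, ?_⟩
  rw [h0, zero_smul, zero_add] at e
  exact e

end WA
end

section
namespace WA
open Polynomial
set_option linter.all false

section
variable {K : Type} [Field K] [CharZero K]

theorem inj_of_hom {B : Type} [Ring B] [Nontrivial B] [Algebra K B] (f : Weyl K →ₐ[K] B) :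
    Function.Injective f := by
  have key : ∀ n : ℕ, ∀ a : Weyl K, dx a + dy a ≤ n → f a = 0 → a = 0 := by
    intro n
    induction n using Nat.strong_induction_on with
    | _ n ih =>
      intro a ha hfa
      have hx : ∀ i j, cf a (i + 1) j = 0 := by
        intro i j
        by_cases h0 : dx a = 0
        · exact cf_dx _ _ _ (by omega)
        · have hb : Wy K * a - a * Wy K = 0 := by
            refine ih (dx a - 1 + dy a) (by omega) _ ?_ (by simp [hfa])
            refine Nat.add_le_add (dx_le _ _ fun i j hi => ?_) (dy_le _ _ fun i j hj => ?_)
            · rw [cf_comm_y, cf_dx _ _ _ (by omega), zero_mul]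
            · rw [cf_comm_y, cf_dy _ _ _ hj, zero_mul]
          have e := cf_comm_y a i j
          rw [hb, cf_zero] at e
          exact (mul_eq_zero.1 e.symm).resolve_right (by exact_mod_cast Nat.succ_ne_zero i)
      have hy : ∀ i j, cf a i (j + 1) = 0 := by
        intro i j
        by_cases h0 : dy a = 0
        · exact cf_dy _ _ _ (by omega)
        · have hb : a * Wx K - Wx K * a = 0 := by
            refine ih (dx a + (dy a - 1)) (by omega) _ ?_ (by simp [hfa])
            refine Nat.add_le_add (dx_le _ _ fun i j hi => ?_) (dy_le _ _ fun i j hj => ?_)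
            · rw [cf_comm_x, cf_dx _ _ _ hi, zero_mul]
            · rw [cf_comm_x, cf_dy _ _ _ (by omega), zero_mul]
          have e := cf_comm_x a i j
          rw [hb, cf_zero] at e
          exact (mul_eq_zero.1 e.symm).resolve_right (by exact_mod_cast Nat.succ_ne_zero j)
      have m1 : (1 : Weyl K) = mo 0 0 := by simp [mo]
      have e : a = cf a 0 0 • (1 : Weyl K) := by
        apply cf_ext
        intro i j
        rw [m1, cf_smul, cf_mo]
        rcases i with _ | i
        · rcases j with _ | j
          · simp
          · rw [hy]; simp
        · rw [hx]; simp
      rw [e, map_smul, map_one] at hfa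
      have : cf a 0 0 = 0 := by
        by_contra hne
        exact one_ne_zero ((smul_eq_zero.1 hfa).resolve_left hne)
      rw [e, this, zero_smul]
  rw [injective_iff_map_eq_zero]
  intro a ha
  exact key _ a le_rfl ha

theorem abs_iota {A : Type} [Ring A] [Algebra K A] (x y : A) (h : y * x = x * y + 1) :
    ((1 / 2 : K) • (y - x)) * (x + y) = (x + y) * ((1 / 2 : K) • (y - x)) + 1 := by
  simp only [smul_mul_assoc, mul_smul_comm, sub_mul, mul_add, add_mul, mul_sub, h]
  module

theorem abs_kappa {A : Type} [Ring A] [Algebra K A] (x y : A) (h : y * x = x * y + 1) :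
    ((1 / 2 : K) • x + y) * ((1 / 2 : K) • x - y) = ((1 / 2 : K) • x - y) * ((1 / 2 : K) • x + y) + 1 := by
  simp only [smul_mul_assoc, mul_smul_comm, sub_mul, mul_add, add_mul, mul_sub, h]
  module

def iot : Weyl K →ₐ[K] Weyl K :=
  lift (Wx K + Wy K) ((1 / 2 : K) • (Wy K - Wx K)) (abs_iota _ _ rel)

def kap : Weyl K →ₐ[K] Weyl K :=
  lift ((1 / 2 : K) • Wx K - Wy K) ((1 / 2 : K) • Wx K + Wy K) (abs_kappa _ _ rel)

theorem iot_x : iot (Wx K) = Wx K + Wy K := lift_x _ _ _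
theorem iot_y : iot (Wy K) = (1 / 2 : K) • (Wy K - Wx K) := lift_y _ _ _
theorem kap_x : kap (Wx K) = (1 / 2 : K) • Wx K - Wy K := lift_x _ _ _
theorem kap_y : kap (Wy K) = (1 / 2 : K) • Wx K + Wy K := lift_y _ _ _

theorem kap_iot (a : Weyl K) : kap (iot a) = a := by
  have : (kap.comp iot : Weyl K →ₐ[K] Weyl K) = AlgHom.id K _ := by
    apply hom_ext
    · simp only [AlgHom.comp_apply, iot_x, map_add, kap_x, kap_y, AlgHom.id_apply]
      module
    · simp only [AlgHom.comp_apply, iot_y, map_smul, map_sub, kap_x, kap_y, AlgHom.id_apply]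
      module
  exact DFunLike.congr_fun this a

theorem iot_kap (a : Weyl K) : iot (kap a) = a := by
  have : (iot.comp kap : Weyl K →ₐ[K] Weyl K) = AlgHom.id K _ := by
    apply hom_ext
    · simp only [AlgHom.comp_apply, iot_x, iot_y, map_smul, map_sub, kap_x, AlgHom.id_apply]
      module
    · simp only [AlgHom.comp_apply, iot_x, iot_y, map_smul, map_add, kap_y, AlgHom.id_apply]
      module
  exact DFunLike.congr_fun this a

theorem st_kap (a : Weyl K) : st (kap a) = kap (al a) := by
  have h : a ∈ LinearMap.ker (st ∘ₗ (kap (K := K)).toLinearMap - (kap (K := K)).toLinearMap ∘ₗ al) := by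
    have gx : st (kap (Wx K)) = kap (Wy K) := by
      rw [kap_x, kap_y, map_sub, map_smul, st_x, st_y, sub_neg_eq_add]
    have gy : st (kap (Wy K)) = kap (Wx K) := by
      rw [kap_x, kap_y, map_add, map_smul, st_x, st_y, sub_eq_add_neg]
    apply ind
    · simp
    · intro b hb
      simp only [LinearMap.mem_ker, LinearMap.sub_apply, LinearMap.comp_apply, AlgHom.toLinearMap_apply,
        sub_eq_zero] at hb ⊢
      rw [map_mul, st_mul, al_mul, map_mul, hb, gx, al_x]
    · intro b hb
      simp only [LinearMap.mem_ker, LinearMap.sub_apply, LinearMap.comp_apply, AlgHom.toLinearMap_apply,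
        sub_eq_zero] at hb ⊢
      rw [map_mul, st_mul, al_mul, map_mul, hb, gy, al_y]
  simpa [sub_eq_zero] using h

theorem surj_st (h : Weyl K →ₐ[K] Weyl K) (hT : st (h (Wy K)) = - h (Wy K)) : Function.Surjective h := by
  have r : h (Wy K) * h (Wx K) = h (Wx K) * h (Wy K) + 1 := by
    rw [← map_mul, rel, map_add, map_mul, map_one]
  obtain ⟨c, hc⟩ := main _ _ r hT
  have hc0 : c ≠ 0 := by
    rintro rfl
    rw [zero_smul] at hc
    rw [hc, zero_mul, mul_zero, zero_add] at r
    exact zero_ne_one r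
  have hy : Wy K ∈ h.range := ⟨c⁻¹ • Wy K, by
    show h (c⁻¹ • Wy K) = _
    rw [map_smul, hc, smul_smul, inv_mul_cancel₀ hc0, one_smul]⟩
  have hcomm : Wy K * h (Wx K) - h (Wx K) * Wy K = c⁻¹ • (1 : Weyl K) := by
    rw [hc, smul_mul_assoc, mul_smul_comm] at r
    have : c • (Wy K * h (Wx K) - h (Wx K) * Wy K) = 1 := by
      rw [smul_sub, r, add_sub_cancel_left]
    rw [← this, smul_smul, inv_mul_cancel₀ hc0, one_smul]
  set S := h (Wx K) with hS
  have m1 : (1 : Weyl K) = mo 0 0 := by simp [mo]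
  have m2 : Wx K = mo 1 0 := by simp [mo]
  have hD : ∀ i j, cf (S - c⁻¹ • Wx K) (i + 1) j = 0 := by
    intro i j
    have e := cf_comm_y S i j
    rw [hcomm, m1, cf_smul, cf_mo] at e
    have hi : ((i : K) + 1) ≠ 0 := by exact_mod_cast Nat.succ_ne_zero i
    apply mul_right_cancel₀ hi
    rw [cf_sub, sub_mul, ← e, m2, cf_smul, cf_mo]
    rcases i with _ | i
    · rcases j with _ | j <;> simp
    · simp
  have hDm : S - c⁻¹ • Wx K ∈ h.range := by
    obtain ⟨N, hN⟩ := eq_sum (S - c⁻¹ • Wx K)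
    rw [hN N le_rfl]
    refine Subalgebra.sum_mem _ fun i _ => Subalgebra.sum_mem _ fun j _ => ?_
    rcases i with _ | i
    · refine Subalgebra.smul_mem _ ?_ _
      rw [mo, pow_zero, one_mul]
      exact Subalgebra.pow_mem _ hy j
    · rw [hD, zero_smul]; exact Subalgebra.zero_mem _
  have hx : Wx K ∈ h.range := by
    have h1 : c⁻¹ • Wx K ∈ h.range := by
      have := Subalgebra.sub_mem _ (⟨Wx K, rfl⟩ : S ∈ h.range) hDm
      rwa [sub_sub_cancel] at this
    have := Subalgebra.smul_mem _ h1 c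
    rwa [smul_smul, mul_inv_cancel₀ hc0, one_smul] at this
  have htop : h.range = ⊤ := by
    rw [eq_top_iff, ← adjoin_top, Algebra.adjoin_le_iff]
    rintro b (rfl | rfl)
    · exact hx
    · exact hy
  exact (AlgHom.range_eq_top h).1 htop

theorem surj_al (h : Weyl K →ₐ[K] Weyl K) (hal : ∀ a, al (h a) = h (al a)) : Function.Surjective h := by
  have hs : Function.Surjective ((kap.comp h).comp iot : Weyl K →ₐ[K] Weyl K) := by
    apply surj_st
    simp only [AlgHom.comp_apply]
    rw [st_kap, hal, iot_y, map_smul, map_sub, al_x, al_y, ← map_neg, ← map_neg]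
    congr 2
    module
  intro b
  obtain ⟨a, ha⟩ := hs (kap b)
  refine ⟨iot a, ?_⟩
  simp only [AlgHom.comp_apply] at ha
  rw [← iot_kap (h (iot a)), ha, iot_kap]

def toHom (f : Weyl K → Weyl K) (hf : IsAlgEndo K f) : Weyl K →ₐ[K] Weyl K :=
  AlgHom.ofLinearMap ⟨⟨f, hf.1⟩, hf.2.1⟩ hf.2.2.2 hf.2.2.1

theorem toHom_apply (f : Weyl K → Weyl K) (hf : IsAlgEndo K f) (a : Weyl K) : toHom f hf a = f a := rfl

theorem final (α : Weyl K → Weyl K) (hα : IsExchange K α)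
    (hB : ∀ γ : Weyl K → Weyl K, IsInvolutionOn K γ → ConjToAlpha K α γ)
    (f : Weyl K → Weyl K) (hf : IsAlgEndo K f)
    (T : Subalgebra K (Weyl K)) (hT : T = Algebra.adjoin K {f (Wx K), f (Wy K)})
    (hP : α (f (Wx K)) ∈ T) (hQ : α (f (Wy K)) ∈ T) : IsAlgAuto K f := by
  have hαal : ∀ a, α a = al a := by
    have hE : IsAlgEndo K (fun a => α (al a)) := by
      obtain ⟨⟨⟨⟨h1, h2, h3, h4⟩, -⟩, -⟩, -⟩ := hα
      refine ⟨fun a b => ?_, fun c a => ?_, fun a b => ?_, ?_⟩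
      · show α (al (a + b)) = _
        rw [map_add, h1]
      · show α (al (c • a)) = _
        rw [map_smul, h2]
      · show α (al (a * b)) = _
        rw [al_mul, h3]
      · show α (al 1) = _
        rw [al_one, h4]
    have : toHom _ hE = AlgHom.id K _ := by
      apply hom_ext
      · show α (al (Wx K)) = _
        rw [al_x, hα.2.2]; rfl
      · show α (al (Wy K)) = _
        rw [al_y, hα.2.1]; rfl
    intro a
    have := DFunLike.congr_fun this (al a)
    rw [toHom_apply, al_al] at this
    exact this
  set F := toHom f hf with hF
  have hFa : ∀ a, F a = f a := fun a => rfl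
  have hTr : T = F.range := by
    rw [hT, ← Algebra.map_top, ← adjoin_top, AlgHom.map_adjoin, Set.image_pair]; rfl
  rw [hTr, hαal] at hP hQ
  have hst : ∀ a, al (F a) ∈ F.range := by
    intro a
    have : a ∈ (Subalgebra.toSubmodule F.range).comap (al ∘ₗ F.toLinearMap) := by
      apply ind
      · rw [Submodule.mem_comap, LinearMap.comp_apply, AlgHom.toLinearMap_apply, map_one, al_one]
        exact F.range.one_mem
      · intro b hb
        rw [Submodule.mem_comap, LinearMap.comp_apply, AlgHom.toLinearMap_apply] at hb ⊢
        rw [map_mul, al_mul]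
        exact F.range.mul_mem hb hP
      · intro b hb
        rw [Submodule.mem_comap, LinearMap.comp_apply, AlgHom.toLinearMap_apply] at hb ⊢
        rw [map_mul, al_mul]
        exact F.range.mul_mem hb hQ
    exact this
  have hinj : Function.Injective F := inj_of_hom F
  have hst' : ∀ a, ∃ b, F b = al (F a) := hst
  choose γ hγ using hst'
  have hγγ : ∀ a, γ (γ a) = a := fun a => hinj (by rw [hγ, hγ, al_al])
  have hinv : IsInvolutionOn K γ := by
    refine ⟨⟨⟨fun a b => hinj ?_, fun c a => hinj ?_, fun a b => hinj ?_, hinj ?_⟩, ?_⟩, funext hγγ⟩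
    · rw [hγ, map_add, map_add, map_add, hγ, hγ]
    · rw [hγ, map_smul, map_smul, map_smul, hγ]
    · rw [hγ, map_mul F a b, al_mul, map_mul F, hγ, hγ]
    · rw [hγ, map_one, al_one]
    · exact Function.Involutive.bijective hγγ
  obtain ⟨g, hg, hgγ⟩ := hB γ hinv
  have hgs : Function.Surjective g := by
    rcases hg with h | h
    · exact h.2.2
    · exact h.2.2
  have hg1 : ∀ a, g (γ a) = al (g a) := by
    intro a
    rw [hgγ]
    show g (Function.invFun g (α (g a))) = _
    rw [Function.rightInverse_invFun hgs, hαal]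
  have hg2 : ∃ g' : Weyl K → Weyl K, IsAlgAuto K g' ∧ ∀ a, g' (γ a) = al (g' a) := by
    rcases hg with h | h
    · exact ⟨g, h, hg1⟩
    · obtain ⟨⟨h1, h2, h3, h4⟩, h5⟩ := h
      refine ⟨fun a => al (g a), ⟨⟨fun a b => ?_, fun c a => ?_, fun a b => ?_, ?_⟩, ?_⟩, fun a => ?_⟩
      · show al (g (a + b)) = _
        rw [h1, map_add]
      · show al (g (c • a)) = _
        rw [h2, map_smul]
      · show al (g (a * b)) = _
        rw [h3, al_mul]
      · show al (g 1) = _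
        rw [h4, al_one]
      · exact (Function.Involutive.bijective (f := fun a : Weyl K => al a) al_al).comp h5
      · show al (g (γ a)) = _
        rw [hg1]
  obtain ⟨g', hg', hgg⟩ := hg2
  let e : Weyl K ≃ₐ[K] Weyl K := AlgEquiv.ofBijective (toHom g' hg'.1) hg'.2
  have he : ∀ a, e (γ a) = al (e a) := hgg
  have hs : Function.Surjective (F.comp e.symm.toAlgHom) := by
    apply surj_al
    intro a
    show al (F (e.symm a)) = F (e.symm (al a))
    rw [← hγ]
    congr 1
    apply e.injective
    rw [he, e.apply_symm_apply, e.apply_symm_apply]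
  refine ⟨hf, hinj, fun b => ?_⟩
  obtain ⟨a, ha⟩ := hs b
  exact ⟨e.symm a, ha⟩

end
end WA
end

/-- restriction condition, second version: assuming every involution on
`A₁` is conjugate to `α`, if `α` maps `P = f X` and `Q = f Y` into the image
`T = f(A₁)` (the subalgebra generated by `P` and `Q`), then `f` is an automorphism. -/
theorem stmt_11 {K : Type} [Field K] [CharZero K]
    (α : Weyl K → Weyl K) (hα : IsExchange K α)
    (hB : ∀ γ : Weyl K → Weyl K, IsInvolutionOn K γ → ConjToAlpha K α γ)
    (f : Weyl K → Weyl K) (hf : IsAlgEndo K f)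
    (T : Subalgebra K (Weyl K)) (hT : T = Algebra.adjoin K {f (Wx K), f (Wy K)})
    (hP : α (f (Wx K)) ∈ T) (hQ : α (f (Wy K)) ∈ T) :
    IsAlgAuto K f := by
  exact WA.final α hα hB f hf T hT hP hQ
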